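/- Theorem 3.1(B): With the parameter choices θ_t = (t-1)/t, β_t = 2/(t+1), α_t = 1/(16(L_yx + L_yy + ρσ_{y,Φ}√t)), τ_t = t/(2(2L + (L_xx + L_yx)t + ρ'(σ_{x,Φ}+σ_{x,f})t^{3/2})) for constants ρ, ρ' > 0, if additionally the gradient noises are conditionally sub-Gaussian (E[exp(‖δ^t_{y,Φ}‖_*²/σ_{y,Φ}²) | F_{t-1}] ≤ e, and similarly for δ^t_{x,Φ} with σ_{x,Φ} and δ^t_{x,f} with σ_{x,f}, a.s.), then for every T ≥ 3 and ς ∈ (0,1/6], with probability at least 1 - 6ς: G(x̄ᵀ, ȳᵀ) ≤ B_E(T) + (8σ_{y,Φ}/√T)(log(1/ς)/ρ + √(log(1/ς)) D_Y) + (8(σ_{x,Φ}+σ_{x,f})/√T)(log(1/ς)/ρ' + √(log(1/ς)) D_X), where B_E(T) := 16LΩ_{hX}/(T(T-1)) + 8(L_xx+L_yx)Ω_{hX}/T + 128(L_yx+L_yy)Ω_{hY}/T + (8σ_{y,Φ}/√T)(1/ρ + 16ρΩ_{hY}) + (8(σ_{x,f}+σ_{x,Φ})/√T)(1/ρ' +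 ρ'Ω_{hX}), and D_X, D_Y are the diameters of X, Y. -/

import Mathlib

open Filter Topology MeasureTheory ENNReal

section Preliminaries

variable {𝕌 : Type*} [NormedAddCommGroup 𝕌] [NormedSpace ℝ 𝕌]

/-- Convexity for extended-real-valued functions. -/
def EConvex (h : 𝕌 → EReal) : Prop :=
  ∀ u v : 𝕌, ∀ a b : ℝ, 0 ≤ a → 0 ≤ b → a + b = 1 →
    h (a • u + b • v) ≤ (a : EReal) * h u + (b : EReal) * h v

/-- A CCP (convex, closed, proper) extended-real-valued function. -/
def IsCCP (h : 𝕌 → EReal) : Prop :=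
  EConvex h ∧ LowerSemicontinuous h ∧ (∀ u, h u ≠ ⊥) ∧ (∃ u, h u ≠ ⊤)

/-- The effective domain of an extended-real-valued function. -/
def edom (h : 𝕌 → EReal) : Set 𝕌 := {u | h u < ⊤}

/-- The Bregman distance associated with `h` with gradient field `Dh`. -/
noncomputable def Dbreg (h : 𝕌 → EReal) (Dh : 𝕌 → 𝕌 →L[ℝ] ℝ) (u u' : 𝕌) : EReal :=
  h u - h u' - (((Dh u') (u - u') : ℝ) : EReal)

/-- Essential smoothness of `h` with gradient field `Dh`. -/
def EssentiallySmooth (h : 𝕌 → EReal) (Dh : 𝕌 → 𝕌 →L[ℝ] ℝ) : Prop :=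
  (interior (edom h)).Nonempty ∧
  (∀ u ∈ interior (edom h), HasFDerivAt (fun v => (h v).toReal) (Dh u) u) ∧
  ContinuousOn Dh (interior (edom h)) ∧
  ∀ u ∈ frontier (edom h), ∀ s : ℕ → 𝕌,
    (∀ n, s n ∈ interior (edom h)) → Tendsto s atTop (𝓝 u) →
      Tendsto (fun n => ‖Dh (s n)‖) atTop atTop

/-- `h` is a distance generating function (DGF) on `𝒰` with gradient field `Dh`. -/
def IsDGF (h : 𝕌 → EReal) (Dh : 𝕌 → 𝕌 →L[ℝ] ℝ) (𝒰 : Set 𝕌) : Prop :=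
  IsCCP h ∧ ContinuousOn h 𝒰 ∧ EssentiallySmooth h Dh ∧
  ∀ u ∈ 𝒰, ∀ u' ∈ 𝒰 ∩ interior (edom h),
    (((1 / 2 * ‖u - u'‖ ^ 2 : ℝ)) : EReal) ≤ Dbreg h Dh u u'

/-- Conversion of an extended real to `ℝ≥0∞` (for taking expectations of the duality gap,
which is nonnegative). -/
noncomputable def toENN (x : EReal) : ℝ≥0∞ := if x = ⊤ then ⊤ else ENNReal.ofReal x.toReal

end Preliminaries

section SaddlePoint

variable {𝕏 𝕐 : Type*} [NormedAddCommGroup 𝕏] [NormedSpace ℝ 𝕏]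
  [NormedAddCommGroup 𝕐] [NormedSpace ℝ 𝕐]

/-- The saddle function `S(x,y) = f(x) + g(x) + Φ(x,y) - J(y)`. -/
noncomputable def spS (f : 𝕏 → ℝ) (g : 𝕏 → EReal) (Φ : 𝕏 → 𝕐 → ℝ) (J : 𝕐 → EReal)
    (x : 𝕏) (y : 𝕐) : EReal :=
  ((f x : ℝ) : EReal) + g x + ((Φ x y : ℝ) : EReal) - J y

/-- The duality gap `G(x,y) = sup_{y'∈Y} S(x,y') - inf_{x'∈X} S(x',y)`. -/
noncomputable def spGap (X : Set 𝕏) (Y : Set 𝕐) (f : 𝕏 → ℝ) (g : 𝕏 → EReal)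
    (Φ : 𝕏 → 𝕐 → ℝ) (J : 𝕐 → EReal) (x : 𝕏) (y : 𝕐) : EReal :=
  (⨆ y' ∈ Y, spS f g Φ J x y') - (⨅ x' ∈ X, spS f g Φ J x' y)

end SaddlePoint



section Analysis

variable {E : Type*} [NormedAddCommGroup E] [NormedSpace ℝ E]

lemma aux_hasDeriv_segment {f : E → ℝ} {f' : E →L[ℝ] ℝ} {x y : E} {r : ℝ}
    (hf : HasFDerivAt f f' (x + r • (y - x))) :
    HasDerivAt (fun r : ℝ => f (x + r • (y - x))) (f' (y - x)) r := by
  have h1 : HasDerivAt (fun r : ℝ => x + r • (y - x)) (y - x) r := by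
    have := ((hasDerivAt_id r).smul_const (y - x)).const_add x
    simpa using this
  exact hf.comp_hasDerivAt r h1

lemma aux_limit_le {ψ : ℝ → ℝ} {d c : ℝ} (hψ : HasDerivAt ψ d 0)
    (h : ∀ ε : ℝ, 0 < ε → ε < 1 → ψ ε - ψ 0 ≤ ε * c) : d ≤ c := by
  have h1 := hψ.tendsto_slope_zero_right
  refine le_of_tendsto h1 ?_
  have : Set.Ioo (0:ℝ) 1 ∈ 𝓝[>] (0:ℝ) := Ioo_mem_nhdsGT one_pos
  filter_upwards [this] with ε hε
  have := h ε hε.1 hε.2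
  simp only [zero_add, smul_eq_mul]
  rw [inv_mul_le_iff₀ hε.1]
  exact this

lemma aux_convex_grad {X : Set E} {f : E → ℝ} {f' : E →L[ℝ] ℝ} {x y : E}
    (hc : ConvexOn ℝ X f) (hx : x ∈ X) (hy : y ∈ X) (hf : HasFDerivAt f f' x) :
    f x + f' (y - x) ≤ f y := by
  have h := aux_hasDeriv_segment (f := f) (f' := f') (x := x) (y := y) (r := 0) (by simpa using hf)
  have := aux_limit_le (c := f y - f x) h (by
    intro ε h0 h1
    have := hc.2 hx hy (show (0:ℝ) ≤ 1 - ε by linarith) h0.le (by ring)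
    have e : (1 - ε) • x + ε • y = x + ε • (y - x) := by module
    rw [e] at this
    simp only [smul_eq_mul] at this
    simp only [zero_smul, add_zero]
    linarith)
  linarith

lemma aux_descent {X : Set E} {f : E → ℝ} {Df : E → E →L[ℝ] ℝ} {L : ℝ} {x y : E}
    (hX : Convex ℝ X) (hx : x ∈ X) (hy : y ∈ X)
    (hf : ∀ x ∈ X, HasFDerivAt f (Df x) x)
    (hL : ∀ x ∈ X, ∀ x' ∈ X, ‖Df x - Df x'‖ ≤ L * ‖x - x'‖) :
    f y ≤ f x + Df x (y - x) + L / 2 * ‖y - x‖ ^ 2 := by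
  have hmem : ∀ r ∈ Set.Icc (0:ℝ) 1, x + r • (y - x) ∈ X := by
    intro r hr
    exact hX.add_smul_sub_mem hx hy hr
  let φ : ℝ → ℝ := fun r => f (x + r • (y - x))
  let B : ℝ → ℝ := fun r => f x + r * Df x (y - x) + r ^ 2 * (L / 2 * ‖y - x‖ ^ 2)
  have hφ : ∀ r ∈ Set.Icc (0:ℝ) 1, HasDerivAt φ (Df (x + r • (y - x)) (y - x)) r :=
    fun r hr => aux_hasDeriv_segment (hf _ (hmem r hr))
  have hB : ∀ r, HasDerivAt B (Df x (y - x) + 2 * r * (L / 2 * ‖y - x‖ ^ 2)) r := by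
    intro r
    have h1 := ((hasDerivAt_id r).mul_const (Df x (y - x))).const_add (f x)
    have h2 := ((hasDerivAt_pow 2 r)).mul_const (L / 2 * ‖y - x‖ ^ 2)
    have h3 : HasDerivAt B _ r := h1.add h2
    exact h3.congr_deriv (by norm_num)
  have := image_le_of_deriv_right_le_deriv_boundary (f := φ) (a := 0) (b := 1)
    (f' := fun r => Df (x + r • (y - x)) (y - x)) (B := B)
    (B' := fun r => Df x (y - x) + 2 * r * (L / 2 * ‖y - x‖ ^ 2))
    (fun r hr => (hφ r hr).continuousAt.continuousWithinAt)
    (fun r hr => (hφ r ⟨hr.1, hr.2.le⟩).hasDerivWithinAt)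
    (by simp [φ, B]) (fun r hr => (hB r).continuousAt.continuousWithinAt)
    (fun r hr => (hB r).hasDerivWithinAt)
    (by
      intro r hr
      have h1 := hL _ (hmem r ⟨hr.1, hr.2.le⟩) x hx
      have h2 := (Df (x + r • (y - x)) - Df x).le_opNorm (y - x)
      have h3 : (Df (x + r • (y - x)) - Df x) (y - x) ≤ ‖(Df (x + r • (y - x)) - Df x) (y - x)‖ :=
        Real.le_norm_self _
      have h4 : ‖x + r • (y - x) - x‖ = r * ‖y - x‖ := by
        rw [add_sub_cancel_left, norm_smul, Real.norm_of_nonneg hr.1]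
      rw [h4] at h1
      have h5 := mul_le_mul_of_nonneg_right h1 (norm_nonneg (y - x))
      have h6 : (Df (x + r • (y - x)) - Df x) (y - x)
        = Df (x + r • (y - x)) (y - x) - Df x (y - x) := rfl
      rw [h6] at h2 h3
      nlinarith)
    (x := 1) (by simp)
  simpa [φ, B] using this

/-- EReal convexity in real terms. -/
lemma aux_econvex_real {h : E → EReal} (hc : EConvex h) (hb : ∀ u, h u ≠ ⊥) {u v : E}
    {a b : ℝ} (ha : 0 ≤ a) (hb0 : 0 ≤ b) (hab : a + b = 1)
    (hu : a = 0 ∨ h u ≠ ⊤) (hv : h v ≠ ⊤) :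
    h (a • u + b • v) ≠ ⊤ ∧
      (h (a • u + b • v)).toReal ≤ a * (h u).toReal + b * (h v).toReal := by
  rcases hu with rfl | hu
  · have : b = 1 := by linarith
    subst this
    simp [hv]
  · have := hc u v a b ha hb0 hab
    lift h u to ℝ using ⟨hu, hb u⟩ with p hp
    lift h v to ℝ using ⟨hv, hb v⟩ with q hq
    have e : (a : EReal) * (p : EReal) + (b : EReal) * (q : EReal)
      = ((a * p + b * q : ℝ) : EReal) := by push_cast; rfl
    rw [e] at this
    have ht : h (a • u + b • v) ≠ ⊤ := fun hh => by
      rw [hh, top_le_iff] at this; exact EReal.coe_ne_top _ this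
    refine ⟨ht, ?_⟩
    lift h (a • u + b • v) to ℝ using ⟨ht, hb _⟩ with r hr
    simpa using EReal.coe_le_coe_iff.1 this

/-- Real-valued Bregman distance. -/
noncomputable def rBreg (h : E → EReal) (Dh : E → E →L[ℝ] ℝ) (u u' : E) : ℝ :=
  (h u).toReal - (h u').toReal - Dh u' (u - u')

lemma aux_Dbreg_eq {h : E → EReal} {Dh : E → E →L[ℝ] ℝ} {u u' : E}
    (hb : ∀ u, h u ≠ ⊥) (hu : h u ≠ ⊤) (hu' : h u' ≠ ⊤) :
    Dbreg h Dh u u' = ((rBreg h Dh u u' : ℝ) : EReal) := by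
  unfold Dbreg rBreg
  lift h u to ℝ using ⟨hu, hb u⟩ with p hp
  lift h u' to ℝ using ⟨hu', hb u'⟩ with q hq
  push_cast
  simp

structure DGFData (h : E → EReal) (Dh : E → E →L[ℝ] ℝ) (U : Set E) (Om : ℝ) : Prop where
  bot : ∀ u, h u ≠ ⊥
  cvx : EConvex h
  cont : ContinuousOn (fun u => (h u).toReal) U
  fin : ∀ u ∈ U, h u ≠ ⊤
  eq : ∀ u ∈ U, ∀ u' ∈ U, Dbreg h Dh u u' = ((rBreg h Dh u u' : ℝ) : EReal)
  lower : ∀ u ∈ U, ∀ u' ∈ U ∩ interior (edom h), 1 / 2 * ‖u - u'‖ ^ 2 ≤ rBreg h Dh u u'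
  upper : ∀ u ∈ U, ∀ u' ∈ U ∩ interior (edom h), rBreg h Dh u u' ≤ Om
  deriv : ∀ u ∈ interior (edom h), HasFDerivAt (fun v => (h v).toReal) (Dh u) u

lemma aux_dgfData {h : E → EReal} {Dh : E → E →L[ℝ] ℝ} {U : Set E} {Om : ℝ}
    (hd : IsDGF h Dh U)
    (hO : (⨆ x ∈ U, ⨆ x' ∈ U ∩ interior (edom h), Dbreg h Dh x x') = (Om : EReal))
    (hne : (U ∩ interior (edom h)).Nonempty) : DGFData h Dh U Om := by
  obtain ⟨⟨hc, hl, hb, hp⟩, hcont, ⟨_, hder, _, _⟩, hlow⟩ := hd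
  have hupE : ∀ u ∈ U, ∀ u' ∈ U ∩ interior (edom h), Dbreg h Dh u u' ≤ (Om : EReal) := by
    intro u hu u' hu'
    rw [← hO]
    exact le_iSup₂_of_le u hu (le_iSup₂_of_le (f := fun x' _ => Dbreg h Dh u x') u' hu' le_rfl)
  have hint : ∀ u ∈ interior (edom h), h u ≠ ⊤ := by
    intro u hu
    have h1 : u ∈ edom h := interior_subset hu
    exact ne_of_lt h1
  have hfin : ∀ u ∈ U, h u ≠ ⊤ := by
    intro u hu htop
    obtain ⟨c, hc1⟩ := hne
    have := hupE u hu c hc1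
    unfold Dbreg at this
    rw [htop] at this
    have h1 := hint c hc1.2
    lift h c to ℝ using ⟨h1, hb c⟩ with q hq
    rw [EReal.top_sub_coe, EReal.top_sub_coe] at this
    exact absurd this (by simp)
  have heq : ∀ u ∈ U, ∀ u' ∈ U, Dbreg h Dh u u' = ((rBreg h Dh u u' : ℝ) : EReal) :=
    fun u hu u' hu' => aux_Dbreg_eq hb (hfin u hu) (hfin u' hu')
  refine ⟨hb, hc, ?_, hfin, heq, ?_, ?_, hder⟩
  · intro u hu
    exact (EReal.tendsto_toReal (hfin u hu) (hb u)).comp (hcont u hu)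
  · intro u hu u' hu'
    have := hlow u hu u' hu'
    rw [heq u hu u' hu'.1] at this
    exact EReal.coe_le_coe_iff.1 this
  · intro u hu u' hu'
    have := hupE u hu u' hu'
    rw [heq u hu u' hu'.1] at this
    exact EReal.coe_le_coe_iff.1 this

lemma aux_prox {h : E → EReal} {Dh : E → E →L[ℝ] ℝ} {U : Set E} {Om : ℝ}
    (hd : DGFData h Dh U Om) (hU : Convex ℝ U)
    {g : E → EReal} (hg : IsCCP g) (hgU : (edom g ∩ U).Nonempty)
    {u0 u1 : E} (h0 : u0 ∈ U ∩ interior (edom h)) (h1 : u1 ∈ U ∩ interior (edom h))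
    (l : E →L[ℝ] ℝ) {η : ℝ}
    (hmin : ∀ x ∈ U, g u1 + ((l (u1 - u0) : ℝ) : EReal) + (η : EReal) * Dbreg h Dh u1 u0
      ≤ g x + ((l (x - u0) : ℝ) : EReal) + (η : EReal) * Dbreg h Dh x u0) :
    g u1 ≠ ⊤ ∧ ∀ x ∈ U, g x ≠ ⊤ →
      (g u1).toReal - (g x).toReal + l (u1 - x)
        ≤ η * (rBreg h Dh x u0 - rBreg h Dh x u1 - rBreg h Dh u1 u0) := by
  obtain ⟨hgc, _, hgb, _⟩ := hg
  have e : ∀ x ∈ U, (η : EReal) * Dbreg h Dh x u0 = ((η * rBreg h Dh x u0 : ℝ) : EReal) := by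
    intro x hx
    rw [hd.eq x hx u0 h0.1]; push_cast; rfl
  have hreal : ∀ x ∈ U, g x ≠ ⊤ → g u1 ≠ ⊤ ∧ (g u1).toReal + l (u1 - u0) + η * rBreg h Dh u1 u0
      ≤ (g x).toReal + l (x - u0) + η * rBreg h Dh x u0 := by
    intro x hx hgx
    have := hmin x hx
    rw [e x hx, e u1 h1.1] at this
    lift g x to ℝ using ⟨hgx, hgb x⟩ with p hp
    have e2 : (p : EReal) + ((l (x - u0) : ℝ) : EReal) + ((η * rBreg h Dh x u0 : ℝ) : EReal)
      = ((p + l (x - u0) + η * rBreg h Dh x u0 : ℝ) : EReal) := by push_cast; rfl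
    rw [e2] at this
    have ht : g u1 ≠ ⊤ := by
      intro hh
      rw [hh, EReal.top_add_coe, EReal.top_add_coe] at this
      exact absurd this (by simp only [top_le_iff]; exact EReal.coe_ne_top _)
    refine ⟨ht, ?_⟩
    lift g u1 to ℝ using ⟨ht, hgb _⟩ with q hq
    have e3 : (q : EReal) + ((l (u1 - u0) : ℝ) : EReal) + ((η * rBreg h Dh u1 u0 : ℝ) : EReal)
      = ((q + l (u1 - u0) + η * rBreg h Dh u1 u0 : ℝ) : EReal) := by push_cast; rfl
    rw [e3] at this
    simpa using EReal.coe_le_coe_iff.1 this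
  obtain ⟨x0, hx0, hx0U⟩ := hgU
  have ht : g u1 ≠ ⊤ := (hreal x0 hx0U (ne_of_lt hx0)).1
  refine ⟨ht, ?_⟩
  intro x hx hgx
  have hder := aux_hasDeriv_segment (f := fun v => (h v).toReal) (f' := Dh u1) (x := u1) (y := x)
    (r := 0) (by simpa using hd.deriv u1 h1.2)
  have key := aux_limit_le (c := (g x).toReal - (g u1).toReal + l (x - u1)
      - η * Dh u0 (x - u1)) (hder.const_mul (-η)) (by
    intro ε he0 he1
    have hmem : u1 + ε • (x - u1) ∈ U := hU.add_smul_sub_mem h1.1 hx ⟨he0.le, he1.le⟩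
    have hcv := aux_econvex_real hgc hgb (u := u1) (v := x) (a := 1 - ε) (b := ε)
      (by linarith) he0.le (by ring) (Or.inr ht) hgx
    have e1 : (1 - ε) • u1 + ε • x = u1 + ε • (x - u1) := by module
    rw [e1] at hcv
    have h2 := (hreal _ hmem hcv.1).2
    have h3 := hcv.2
    unfold rBreg at h2
    have e4 : u1 + ε • (x - u1) - u0 = (u1 - u0) + ε • (x - u1) := by module
    rw [e4] at h2
    simp only [map_add, map_smul, smul_eq_mul] at h2
    simp only [zero_smul, add_zero]
    nlinarith)
  unfold rBreg
  have e5 : u1 - x = -(x - u1) := by abel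
  have e6 : x - u0 = (x - u1) + (u1 - u0) := by abel
  rw [e5, e6]
  simp only [map_add, map_neg]
  nlinarith

lemma aux_midpoint {h : E → EReal} {Dh : E → E →L[ℝ] ℝ} {U : Set E} {Om : ℝ}
    (hd : DGFData h Dh U Om) (hU : Convex ℝ U) (hne : (U ∩ interior (edom h)).Nonempty)
    {u v : E} (hu : u ∈ U) (hv : v ∈ U) :
    2 * (h ((1/2 : ℝ) • u + (1/2 : ℝ) • v)).toReal + ‖u - v‖ ^ 2 / 4
      ≤ (h u).toReal + (h v).toReal := by
  have hdomc : Convex ℝ (edom h) := by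
    intro p hp q hq a b ha hb hab
    have := aux_econvex_real hd.cvx hd.bot ha hb hab (Or.inr (ne_of_lt hp)) (ne_of_lt hq)
    exact lt_of_le_of_ne le_top this.1
  have hin : ∀ u ∈ U ∩ interior (edom h), ∀ v ∈ U ∩ interior (edom h),
      2 * (h ((1/2 : ℝ) • u + (1/2 : ℝ) • v)).toReal + ‖u - v‖ ^ 2 / 4
      ≤ (h u).toReal + (h v).toReal := by
    intro u hu v hv
    have hm : (1/2 : ℝ) • u + (1/2 : ℝ) • v ∈ U ∩ interior (edom h) :=
      (hU.inter hdomc.interior) hu hv (by norm_num) (by norm_num) (by norm_num)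
    have a1 := hd.lower u hu.1 _ hm
    have a2 := hd.lower v hv.1 _ hm
    unfold rBreg at a1 a2
    have e1 : u - ((1/2 : ℝ) • u + (1/2 : ℝ) • v) = (1/2 : ℝ) • (u - v) := by module
    have e2 : v - ((1/2 : ℝ) • u + (1/2 : ℝ) • v) = -((1/2 : ℝ) • (u - v)) := by module
    rw [e1] at a1
    rw [e2, map_neg, norm_neg] at a2
    have e3 : ‖(1/2 : ℝ) • (u - v)‖ = 1/2 * ‖u - v‖ := by
      rw [norm_smul]; norm_num
    rw [e3] at a1 a2
    nlinarith
  obtain ⟨c, hc⟩ := hne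
  have hpath : ∀ w ∈ U, ∀ r ∈ Set.Ioo (0:ℝ) 1, w + r • (c - w) ∈ U ∩ interior (edom h) := by
    intro w hw r hr
    refine ⟨hU.add_smul_sub_mem hw hc.1 ⟨hr.1.le, hr.2.le⟩, ?_⟩
    exact hdomc.add_smul_sub_mem_interior (lt_of_le_of_ne le_top (hd.fin w hw)) hc.2 ⟨hr.1, hr.2.le⟩
  have hev : ∀ᶠ r in 𝓝[>] (0:ℝ), r ∈ Set.Ioo (0:ℝ) 1 := Ioo_mem_nhdsGT one_pos
  have hlim : ∀ w ∈ U, Tendsto (fun r : ℝ => w + r • (c - w)) (𝓝[>] 0) (𝓝 w) := by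
    intro w hw
    have : Continuous (fun r : ℝ => w + r • (c - w)) := by fun_prop
    have := this.tendsto 0
    simp only [zero_smul, add_zero] at this
    exact this.mono_left nhdsWithin_le_nhds
  have hlimH : ∀ w ∈ U, ∀ p : ℝ → E, Tendsto p (𝓝[>] 0) (𝓝 w) → (∀ᶠ r in 𝓝[>] (0:ℝ), p r ∈ U) →
      Tendsto (fun r : ℝ => (h (p r)).toReal) (𝓝[>] 0) (𝓝 ((h w).toReal)) := by
    intro w hw p hp hpU
    exact (hd.cont w hw).tendsto.comp (tendsto_nhdsWithin_iff.2 ⟨hp, hpU⟩)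
  have hm : (1/2 : ℝ) • u + (1/2 : ℝ) • v ∈ U :=
    hU hu hv (by norm_num) (by norm_num) (by norm_num)
  have lu := hlimH u hu _ (hlim u hu) (hev.mono fun r hr => (hpath u hu r hr).1)
  have lv := hlimH v hv _ (hlim v hv) (hev.mono fun r hr => (hpath v hv r hr).1)
  have lm := hlimH _ hm (fun r => (1/2 : ℝ) • (u + r • (c - u)) + (1/2 : ℝ) • (v + r • (c - v)))
    (((hlim u hu).const_smul _).add ((hlim v hv).const_smul _))
    (hev.mono fun r hr => hU (hpath u hu r hr).1 (hpath v hv r hr).1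
      (by norm_num) (by norm_num) (by norm_num))
  refine le_of_tendsto_of_tendsto
    ((lm.const_mul 2).add ((((hlim u hu).sub (hlim v hv)).norm.pow 2).div_const 4))
    (lu.add lv) ?_
  filter_upwards [hev] with r hr
  exact hin _ (hpath u hu r hr) _ (hpath v hv r hr)

/-- Dual averaging map: existence, quadratic growth, continuity. -/
lemma aux_dualmap [FiniteDimensional ℝ E] {h : E → EReal} {Dh : E → E →L[ℝ] ℝ} {U : Set E}
    {Om D : ℝ} (hd : DGFData h Dh U Om) (hU : Convex ℝ U) (hcl : IsClosed U)
    (hD : ∀ x ∈ U, ∀ x' ∈ U, ‖x - x'‖ ≤ D)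
    (hne : (U ∩ interior (edom h)).Nonempty) :
    ∃ Y : (E →L[ℝ] ℝ) → E, Continuous Y ∧ (∀ z, Y z ∈ U) ∧
      ∀ z, ∀ y ∈ U, z y - (h y).toReal + ‖y - Y z‖ ^ 2 / 4 ≤ z (Y z) - (h (Y z)).toReal := by
  obtain ⟨c, hc⟩ := hne
  have hbd : Bornology.IsBounded U := by
    refine (Metric.isBounded_closedBall (x := c) (r := D)).subset ?_
    intro x hx
    rw [mem_closedBall_iff_norm]
    exact hD x hx c hc.1
  have hcomp : IsCompact U := Metric.isCompact_of_isClosed_isBounded hcl hbd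
  have hex : ∀ z : E →L[ℝ] ℝ, ∃ p ∈ U, ∀ y ∈ U,
      z y - (h y).toReal + ‖y - p‖ ^ 2 / 4 ≤ z p - (h p).toReal := by
    intro z
    obtain ⟨p, hp, hmax⟩ := hcomp.exists_isMaxOn ⟨c, hc.1⟩
      (f := fun y => z y - (h y).toReal) (z.continuous.continuousOn.sub hd.cont)
    refine ⟨p, hp, fun y hy => ?_⟩
    have hm : (1/2 : ℝ) • y + (1/2 : ℝ) • p ∈ U :=
      hU hy hp (by norm_num) (by norm_num) (by norm_num)
    have h1 := hmax hm
    have h2 := aux_midpoint hd hU ⟨c, hc⟩ hy hp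
    simp only [Set.mem_ofPred_eq, map_add, map_smul, smul_eq_mul] at h1
    linarith
  choose Y hY hYm using hex
  refine ⟨Y, ?_, hY, hYm⟩
  refine (LipschitzWith.of_dist_le_mul (K := 2) fun z w => ?_).continuous
  have a1 := hYm z (Y w) (hY w)
  have a2 := hYm w (Y z) (hY z)
  have a3 := (z - w).le_opNorm (Y z - Y w)
  have a4 := Real.le_norm_self ((z - w) (Y z - Y w))
  rw [norm_sub_rev (Y w)] at a1
  simp only [_root_.sub_apply, map_sub] at a3 a4
  rw [dist_eq_norm, dist_eq_norm]
  push_cast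
  by_contra hcon
  push Not at hcon
  have : 0 ≤ ‖z - w‖ := norm_nonneg _
  nlinarith

lemma aux_ghost {h : E → EReal} {Dh : E → E →L[ℝ] ℝ} {U : Set E}
    {Om : ℝ} (hd : DGFData h Dh U Om) {c : E} (hc : c ∈ U ∩ interior (edom h))
    {Y : (E →L[ℝ] ℝ) → E} (hYU : ∀ z, Y z ∈ U)
    (hY : ∀ z, ∀ y ∈ U, z y - (h y).toReal + ‖y - Y z‖ ^ 2 / 4 ≤ z (Y z) - (h (Y z)).toReal)
    {η : ℝ} (hη : 0 < η) (ξ : ℕ → E →L[ℝ] ℝ) (n : ℕ) {x : E} (hx : x ∈ U) :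
    ∑ i ∈ Finset.range n, ξ i (x - Y (Dh c + η • ∑ j ∈ Finset.range i, ξ j))
      ≤ Om / η + η * ∑ i ∈ Finset.range n, ‖ξ i‖ ^ 2 := by
  let z : ℕ → E →L[ℝ] ℝ := fun i => Dh c + η • ∑ j ∈ Finset.range i, ξ j
  have hz : ∀ i, z (i+1) = z i + η • ξ i := by
    intro i
    simp only [z, Finset.sum_range_succ, smul_add, add_assoc]
  let V : ℕ → ℝ := fun i => z i (Y (z i)) - (h (Y (z i))).toReal
  have hV : ∀ i, V (i+1) ≤ V i + η * ξ i (Y (z i)) + η ^ 2 * ‖ξ i‖ ^ 2 := by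
    intro i
    have h1 := hY (z i) (Y (z (i+1))) (hYU _)
    have h2 := (ξ i).le_opNorm (Y (z (i+1)) - Y (z i))
    have h3 := Real.le_norm_self (ξ i (Y (z (i+1)) - Y (z i)))
    have h4 : ξ i (Y (z (i+1)) - Y (z i)) = ξ i (Y (z (i+1))) - ξ i (Y (z i)) := map_sub _ _ _
    have h5 : V (i+1) = z i (Y (z (i+1))) + η * ξ i (Y (z (i+1))) - (h (Y (z (i+1)))).toReal := by
      simp only [V]
      rw [hz i]
      simp
    rw [h5]
    simp only [V]
    have h6 : η * (ξ i (Y (z (i+1))) - ξ i (Y (z i))) ≤ η * (‖ξ i‖ * ‖Y (z (i+1)) - Y (z i)‖) := by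
      apply mul_le_mul_of_nonneg_left _ hη.le
      linarith
    nlinarith [sq_nonneg (η * ‖ξ i‖ - ‖Y (z (i+1)) - Y (z i)‖ / 2)]
  have hsum : ∀ n, V n ≤ V 0 + η * ∑ i ∈ Finset.range n, ξ i (Y (z i))
      + η ^ 2 * ∑ i ∈ Finset.range n, ‖ξ i‖ ^ 2 := by
    intro n
    induction n with
    | zero => simp
    | succ k ih =>
      rw [Finset.sum_range_succ, Finset.sum_range_succ]
      have := hV k
      linarith
  have hz0 : z 0 = Dh c := by simp [z]
  have hV0 : V 0 ≤ Dh c c - (h c).toReal := by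
    have := hd.lower (Y (Dh c)) (hYU _) c hc
    unfold rBreg at this
    simp only [V, hz0]
    rw [map_sub] at this
    nlinarith [sq_nonneg ‖Y (Dh c) - c‖]
  have hVn : z n x - (h x).toReal ≤ V n := by
    have := hY (z n) x hx
    simp only [V]
    nlinarith [sq_nonneg ‖x - Y (z n)‖]
  have hzn : z n x = Dh c x + η * ∑ i ∈ Finset.range n, ξ i x := by
    simp [z]
  have hO := hd.upper x hx c hc
  unfold rBreg at hO
  rw [map_sub] at hO
  have hfin : η * ∑ i ∈ Finset.range n, ξ i (x - Y (z i))
      ≤ Om + η ^ 2 * ∑ i ∈ Finset.range n, ‖ξ i‖ ^ 2 := by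
    simp only [map_sub, Finset.sum_sub_distrib]
    have := hsum n
    linarith
  have e : Om / η + η * ∑ i ∈ Finset.range n, ‖ξ i‖ ^ 2
    = (Om + η ^ 2 * ∑ i ∈ Finset.range n, ‖ξ i‖ ^ 2) / η := by field_simp
  rw [e, le_div_iff₀ hη]
  linarith

end Analysis


section Concentration

set_option linter.unusedSectionVars false
set_option linter.unusedVariables false

lemma aux_exp_le (z : ℝ) : Real.exp z ≤ z + Real.exp (z ^ 2) := by
  have h2 := Real.add_one_le_exp (z ^ 2)
  by_cases h : |z| ≤ 1
  · have := (abs_le.1 (Real.abs_exp_sub_one_sub_id_le h)).2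
    linarith
  · rcases le_total 0 z with hz | hz
    · rw [abs_of_nonneg hz] at h
      have : Real.exp z ≤ Real.exp (z ^ 2) := Real.exp_le_exp.2 (by nlinarith)
      linarith
    · rw [abs_of_nonpos hz] at h
      have : Real.exp z ≤ 1 := Real.exp_le_one_iff.2 hz
      nlinarith

lemma aux_exp_pt {a v z : ℝ} (ha : 0 ≤ a) (ha1 : a ≤ 1) (hz : z ^ 2 ≤ a ^ 2 * v) :
    Real.exp z ≤ z + ((1 - a ^ 2) + a ^ 2 * Real.exp v) := by
  have h1 := aux_exp_le z
  have h2 : Real.exp (z ^ 2) ≤ Real.exp (a ^ 2 * v) := Real.exp_le_exp.2 hz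
  have ha2 : a ^ 2 ≤ 1 := by nlinarith
  have h3 := convexOn_exp.2 (Set.mem_univ 0) (Set.mem_univ v)
    (show 0 ≤ 1 - a ^ 2 by linarith) (sq_nonneg a) (by ring)
  simp only [smul_eq_mul, mul_zero, zero_add, Real.exp_zero, mul_one] at h3
  linarith

lemma aux_exp_pt2 {a v z : ℝ} (hv : 0 ≤ v) (hz : z ^ 2 ≤ a ^ 2 * v) :
    Real.exp z ≤ Real.exp (a ^ 2 / 4) * Real.exp v := by
  rw [← Real.exp_add]
  apply Real.exp_le_exp.2
  apply le_of_abs_le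
  apply abs_le_of_sq_le_sq _ (by positivity)
  nlinarith [sq_nonneg (a ^ 2 / 4 - v)]

variable {Ω : Type*} {mΩ : MeasurableSpace Ω} {Pr : Measure Ω} [IsProbabilityMeasure Pr]
  {E : Type*} [NormedAddCommGroup E] [NormedSpace ℝ E] [FiniteDimensional ℝ E]

lemma aux_int_exp_norm {δ : Ω → E →L[ℝ] ℝ} {σ : ℝ} (hσ : 0 < σ)
    (hδ : AEStronglyMeasurable δ Pr)
    (hint : Integrable (fun ω => Real.exp (‖δ ω‖ ^ 2 / σ ^ 2)) Pr) (K : ℝ)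
    {f : Ω → ℝ} (hf : AEStronglyMeasurable f Pr) (hfb : ∀ ω, f ω ≤ K * ‖δ ω‖) :
    Integrable (fun ω => Real.exp (f ω)) Pr := by
  refine (hint.const_mul (Real.exp (K ^ 2 * σ ^ 2 / 4))).mono'
    (Real.continuous_exp.comp_aestronglyMeasurable hf) (ae_of_all _ fun ω => ?_)
  rw [Real.norm_of_nonneg (Real.exp_pos _).le, ← Real.exp_add]
  apply Real.exp_le_exp.2
  refine (hfb ω).trans ?_
  have : K ^ 2 * σ ^ 2 / 4 + ‖δ ω‖ ^ 2 / σ ^ 2 - K * ‖δ ω‖ = (K * σ / 2 - ‖δ ω‖ / σ) ^ 2 := by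
    field_simp; ring
  nlinarith [sq_nonneg (K * σ / 2 - ‖δ ω‖ / σ)]

lemma aux_apply_meas {m : MeasurableSpace Ω} {δ : Ω → E →L[ℝ] ℝ} {u : Ω → E}
    (hδ : StronglyMeasurable[m] δ) (hu : StronglyMeasurable[m] u) :
    StronglyMeasurable[m] (fun ω => δ ω (u ω)) := by
  have hc : Continuous (fun p : (E →L[ℝ] ℝ) × E => p.1 p.2) := by fun_prop
  exact hc.comp_stronglyMeasurable (hδ.prodMk hu)

lemma aux_cond_mgf {m : MeasurableSpace Ω} (hm : m ≤ mΩ) {δ : Ω → E →L[ℝ] ℝ} {u : Ω → E}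
    {σ D c a : ℝ} (hσ : 0 < σ) (ha : 0 ≤ a)
    (hu : StronglyMeasurable[m] u) (huD : ∀ ω, ‖u ω‖ ≤ D)
    (hδm : StronglyMeasurable[mΩ] δ)
    (hδi : Integrable δ Pr) (hδ0 : Pr[δ | m] =ᵐ[Pr] 0)
    (hint : Integrable (fun ω => Real.exp (‖δ ω‖ ^ 2 / σ ^ 2)) Pr)
    (hsg : ∀ᵐ ω ∂Pr, (Pr[fun ω' => Real.exp (‖δ ω'‖ ^ 2 / σ ^ 2) | m]) ω ≤ Real.exp 1)
    (hc : |c| * D * σ ≤ a) :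
    ∀ᵐ ω ∂Pr, (Pr[fun ω' => Real.exp (c * δ ω' (u ω')) | m]) ω ≤ Real.exp (2 * a ^ 2) := by
  have hζm : StronglyMeasurable[mΩ] (fun ω => δ ω (u ω)) := aux_apply_meas hδm (hu.mono hm)
  have hζb : ∀ ω, |δ ω (u ω)| ≤ D * ‖δ ω‖ := by
    intro ω
    have := (δ ω).le_opNorm (u ω)
    rw [Real.norm_eq_abs] at this
    nlinarith [norm_nonneg (δ ω), huD ω]
  have hζi : Integrable (fun ω => δ ω (u ω)) Pr := by
    refine (hδi.norm.const_mul D).mono' hζm.aestronglyMeasurable (ae_of_all _ hζb)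
  have hexpi : Integrable (fun ω => Real.exp (c * δ ω (u ω))) Pr := by
    refine aux_int_exp_norm hσ hδm.aestronglyMeasurable hint (|c| * D)
      (hζm.const_mul c).aestronglyMeasurable fun ω => ?_
    have h1 := le_abs_self (c * δ ω (u ω))
    rw [abs_mul] at h1
    nlinarith [hζb ω, abs_nonneg c]
  have hz : ∀ ω, (c * δ ω (u ω)) ^ 2 ≤ a ^ 2 * (‖δ ω‖ ^ 2 / σ ^ 2) := by
    intro ω
    have h1 : |c * δ ω (u ω)| ≤ a * (‖δ ω‖ / σ) := by
      rw [abs_mul]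
      have h2 : |c| * |δ ω (u ω)| ≤ |c| * (D * ‖δ ω‖) :=
        mul_le_mul_of_nonneg_left (hζb ω) (abs_nonneg c)
      have h3 : |c| * (D * ‖δ ω‖) = (|c| * D * σ) * (‖δ ω‖ / σ) := by field_simp
      rw [h3] at h2
      exact h2.trans (mul_le_mul_of_nonneg_right hc (by positivity))
    have h4 := pow_le_pow_left₀ (abs_nonneg _) h1 2
    rw [sq_abs, mul_pow a, div_pow] at h4
    exact h4
  have hζ0 : Pr[fun ω => δ ω (u ω) | m] =ᵐ[Pr] 0 := by
    have := condExp_bilin_of_stronglyMeasurable_right (μ := Pr) (m := m)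
      (ContinuousLinearMap.id ℝ (E →L[ℝ] ℝ)) (f := δ) (g := u) hu
      (by simpa using hζi) hδi
    simp only [ContinuousLinearMap.id_apply] at this
    filter_upwards [this, hδ0] with ω h1 h2
    rw [h1, h2]; simp
  by_cases ha1 : a ≤ 1
  · have i2 : Integrable (fun ω => a ^ 2 * Real.exp (‖δ ω‖ ^ 2 / σ ^ 2)) Pr := hint.const_mul _
    have i1 : Integrable (fun ω => c * δ ω (u ω)) Pr := hζi.const_mul c
    have ic : Integrable (fun _ : Ω => 1 - a ^ 2) Pr := integrable_const _
    have hle := condExp_mono (m := m) hexpi (i1.add (ic.add i2))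
      (ae_of_all _ fun ω => aux_exp_pt ha ha1 (hz ω))
    have e1 := condExp_add i1 (ic.add i2) m
    have e2 := condExp_add ic i2 m
    have e3 := condExp_smul (μ := Pr) c (fun ω => δ ω (u ω)) m
    have e4 := condExp_smul (μ := Pr) (a ^ 2) (fun ω => Real.exp (‖δ ω‖ ^ 2 / σ ^ 2)) m
    have e5 : Pr[fun _ : Ω => 1 - a ^ 2 | m] = fun _ => 1 - a ^ 2 := condExp_const hm _
    filter_upwards [hle, e1, e2, e3, e4, hζ0, hsg] with ω h1 h2 h3 h4 h5 h6 h7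
    refine h1.trans ?_
    rw [h2, Pi.add_apply, h3, Pi.add_apply, e5]
    have h4' : (Pr[fun ω => c * δ ω (u ω) | m]) ω = c * (Pr[fun ω => δ ω (u ω) | m]) ω := h4
    have h5' : (Pr[fun ω => a ^ 2 * Real.exp (‖δ ω‖ ^ 2 / σ ^ 2) | m]) ω
      = a ^ 2 * (Pr[fun ω => Real.exp (‖δ ω‖ ^ 2 / σ ^ 2) | m]) ω := h5
    rw [h4', h5', h6]
    simp only [Pi.zero_apply, mul_zero, zero_add]
    have h8 := Real.add_one_le_exp (2 * a ^ 2)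
    have h9 := Real.exp_one_lt_three
    nlinarith [mul_le_mul_of_nonneg_left h7 (sq_nonneg a), sq_nonneg a]
  · have i2 : Integrable (fun ω => Real.exp (a ^ 2 / 4) * Real.exp (‖δ ω‖ ^ 2 / σ ^ 2)) Pr :=
      hint.const_mul _
    have hle := condExp_mono (m := m) hexpi i2
      (ae_of_all _ fun ω => aux_exp_pt2 (by positivity) (hz ω))
    have e4 := condExp_smul (μ := Pr) (Real.exp (a ^ 2 / 4))
      (fun ω => Real.exp (‖δ ω‖ ^ 2 / σ ^ 2)) m
    filter_upwards [hle, e4, hsg] with ω h1 h5 h7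
    refine h1.trans ?_
    have h5' : (Pr[fun ω => Real.exp (a ^ 2 / 4) * Real.exp (‖δ ω‖ ^ 2 / σ ^ 2) | m]) ω
      = Real.exp (a ^ 2 / 4) * (Pr[fun ω => Real.exp (‖δ ω‖ ^ 2 / σ ^ 2) | m]) ω := h5
    rw [h5']
    refine (mul_le_mul_of_nonneg_left h7 (Real.exp_pos _).le).trans ?_
    rw [← Real.exp_add]
    apply Real.exp_le_exp.2
    nlinarith

lemma aux_markov {f : Ω → ℝ} {C r s : ℝ} (hi : Integrable (fun ω => Real.exp (f ω)) Pr)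
    (hC : ∫ ω, Real.exp (f ω) ∂Pr ≤ C) (hs : C ≤ s * Real.exp r) :
    Pr {ω | r < f ω} ≤ ENNReal.ofReal s := by
  have h1 := mul_meas_ge_le_integral_of_nonneg (μ := Pr)
    (ae_of_all _ fun ω => (Real.exp_pos (f ω)).le) hi (Real.exp r)
  have h2 : Real.exp r * Pr.real {ω | Real.exp r ≤ Real.exp (f ω)} ≤ s * Real.exp r := by
    linarith
  have h3 : Pr.real {ω | Real.exp r ≤ Real.exp (f ω)} ≤ s := by
    rw [mul_comm] at h2
    exact le_of_mul_le_mul_right h2 (Real.exp_pos r)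
  have h4 : Pr {ω | r < f ω} ≤ Pr {ω | Real.exp r ≤ Real.exp (f ω)} :=
    measure_mono fun ω (h : r < f ω) => Real.exp_le_exp.2 h.le
  refine h4.trans ?_
  rw [← ofReal_measureReal]
  exact ENNReal.ofReal_le_ofReal h3

lemma aux_sum_mgf (F : Filtration ℕ mΩ) {δ : ℕ → Ω → E →L[ℝ] ℝ} {u : ℕ → Ω → E} {w : ℕ → ℝ}
    {σ D : ℝ} (hσ : 0 < σ)
    (hu : ∀ i, StronglyMeasurable[F i] (u i)) (huD : ∀ i ω, ‖u i ω‖ ≤ D)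
    (hδm : ∀ i, StronglyMeasurable[F (i + 1)] (δ i))
    (hδi : ∀ i, Integrable (δ i) Pr) (hδ0 : ∀ i, Pr[δ i | F i] =ᵐ[Pr] 0)
    (hint : ∀ i, Integrable (fun ω => Real.exp (‖δ i ω‖ ^ 2 / σ ^ 2)) Pr)
    (hsg : ∀ i, ∀ᵐ ω ∂Pr, (Pr[fun ω' => Real.exp (‖δ i ω'‖ ^ 2 / σ ^ 2) | F i]) ω ≤ Real.exp 1)
    {a : ℝ} (ha : 0 ≤ a) (l : ℝ) (n : ℕ) (hw : ∀ i < n, |l * w i| * D * σ ≤ a) :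
    ∀ k ≤ n, StronglyMeasurable[F k] (fun ω => ∑ i ∈ Finset.range k, w i * δ i ω (u i ω)) ∧
      (∀ K : ℝ, Integrable
        (fun ω => Real.exp (K * ∑ i ∈ Finset.range k, w i * δ i ω (u i ω))) Pr) ∧
      ∫ ω, Real.exp (l * ∑ i ∈ Finset.range k, w i * δ i ω (u i ω)) ∂Pr
        ≤ Real.exp (k * (2 * a ^ 2)) := by
  intro k
  induction k with
  | zero =>
    intro _
    simp only [Finset.range_zero, Finset.sum_empty]
    refine ⟨stronglyMeasurable_const, fun K => integrable_const _, by simp⟩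
  | succ k ih =>
    intro hk
    obtain ⟨ih1, ih2, ih3⟩ := ih (by omega)
    have hzm : StronglyMeasurable[F (k+1)] (fun ω => δ k ω (u k ω)) :=
      aux_apply_meas (hδm k) ((hu k).mono (F.mono (Nat.le_succ k)))
    have hSm : StronglyMeasurable[F (k+1)]
        (fun ω => ∑ i ∈ Finset.range (k+1), w i * δ i ω (u i ω)) := by
      simp only [Finset.sum_range_succ]
      exact (ih1.mono (F.mono (Nat.le_succ k))).add (hzm.const_mul _)
    have hzi : ∀ K : ℝ, Integrable (fun ω => Real.exp (K * (w k * δ k ω (u k ω)))) Pr := by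
      intro K
      refine aux_int_exp_norm hσ ((hδm k).mono (F.le _)).aestronglyMeasurable (hint k)
        (|K * w k| * D)
        (((hzm.mono (F.le _)).const_mul (w k)).const_mul K).aestronglyMeasurable fun ω => ?_
      have h1 := le_abs_self (K * w k * δ k ω (u k ω))
      rw [abs_mul] at h1
      have h2 := (δ k ω).le_opNorm (u k ω)
      rw [Real.norm_eq_abs] at h2
      have h3 : |δ k ω (u k ω)| ≤ D * ‖δ k ω‖ := by nlinarith [norm_nonneg (δ k ω), huD k ω]
      have h4 := mul_le_mul_of_nonneg_left h3 (abs_nonneg (K * w k))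
      linarith
    have hSi : ∀ K : ℝ, Integrable
        (fun ω => Real.exp (K * ∑ i ∈ Finset.range (k+1), w i * δ i ω (u i ω))) Pr := by
      intro K
      refine ((ih2 (2 * K)).add (hzi (2 * K))).mono'
        (Real.continuous_exp.comp_aestronglyMeasurable
          ((hSm.mono (F.le _)).const_mul K).aestronglyMeasurable) (ae_of_all _ fun ω => ?_)
      rw [Real.norm_of_nonneg (Real.exp_pos _).le, Finset.sum_range_succ, Pi.add_apply]
      set p := ∑ i ∈ Finset.range k, w i * δ i ω (u i ω)
      set q := w k * δ k ω (u k ω)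
      have e1 : Real.exp (2 * K * p) = Real.exp (K * p) ^ 2 := by
        rw [← Real.exp_nat_mul]; congr 1; push_cast; ring
      have e2 : Real.exp (2 * K * q) = Real.exp (K * q) ^ 2 := by
        rw [← Real.exp_nat_mul]; congr 1; push_cast; ring
      rw [mul_add, Real.exp_add, e1, e2]
      nlinarith [sq_nonneg (Real.exp (K * p) - Real.exp (K * q)), Real.exp_pos (K * p),
        Real.exp_pos (K * q), mul_pos (Real.exp_pos (K * p)) (Real.exp_pos (K * q))]
    refine ⟨hSm, hSi, ?_⟩
    let M : Ω → ℝ := fun ω => Real.exp (l * ∑ i ∈ Finset.range k, w i * δ i ω (u i ω))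
    let N : Ω → ℝ := fun ω => Real.exp (l * w k * δ k ω (u k ω))
    have hMN : ∀ ω, Real.exp (l * ∑ i ∈ Finset.range (k+1), w i * δ i ω (u i ω)) = (M * N) ω := by
      intro ω
      simp only [M, N, Pi.mul_apply]
      rw [← Real.exp_add, Finset.sum_range_succ]
      congr 1; ring
    have hMm : StronglyMeasurable[F k] M :=
      Real.continuous_exp.comp_stronglyMeasurable (ih1.const_mul l)
    have hNi : Integrable N Pr := by
      have := hzi l
      simpa only [N, mul_assoc] using this
    have hMNi : Integrable (M * N) Pr := (hSi l).congr (ae_of_all _ hMN)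
    have hpull := condExp_mul_of_aestronglyMeasurable_left hMm.aestronglyMeasurable hMNi hNi
    have hmgf := aux_cond_mgf (F.le k) hσ ha (hu k) (huD k) ((hδm k).mono (F.le _)) (hδi k) (hδ0 k)
      (hint k) (hsg k) (hw k (by omega))
    simp_rw [hMN]
    rw [← integral_condExp (F.le k)]
    have hle : ∫ ω, (Pr[M * N | F k]) ω ∂Pr ≤ ∫ ω, M ω * Real.exp (2 * a ^ 2) ∂Pr := by
      refine integral_mono_ae integrable_condExp ((ih2 l).mul_const _) ?_
      filter_upwards [hpull, hmgf] with ω h1 h2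
      rw [h1, Pi.mul_apply]
      exact mul_le_mul_of_nonneg_left h2 (Real.exp_pos _).le
    refine hle.trans ?_
    rw [integral_mul_const]
    refine (mul_le_mul_of_nonneg_right ih3 (Real.exp_pos _).le).trans ?_
    rw [← Real.exp_add]
    apply Real.exp_le_exp.2
    push_cast
    linarith

lemma aux_lin_tail (F : Filtration ℕ mΩ) {δ : ℕ → Ω → E →L[ℝ] ℝ} {u : ℕ → Ω → E} {w : ℕ → ℝ}
    {σ D : ℝ} (hσ : 0 < σ) (hD : 0 ≤ D)
    (hu : ∀ i, StronglyMeasurable[F i] (u i)) (huD : ∀ i ω, ‖u i ω‖ ≤ D)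
    (hδm : ∀ i, StronglyMeasurable[F (i + 1)] (δ i))
    (hδi : ∀ i, Integrable (δ i) Pr) (hδ0 : ∀ i, Pr[δ i | F i] =ᵐ[Pr] 0)
    (hint : ∀ i, Integrable (fun ω => Real.exp (‖δ i ω‖ ^ 2 / σ ^ 2)) Pr)
    (hsg : ∀ i, ∀ᵐ ω ∂Pr, (Pr[fun ω' => Real.exp (‖δ i ω'‖ ^ 2 / σ ^ 2) | F i]) ω ≤ Real.exp 1)
    (n : ℕ) (hn : 1 ≤ n) (hw : ∀ i < n, |w i| ≤ n) {s : ℝ} (hs : 0 < s) (hs1 : s ≤ 1) :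
    Pr {ω | 4 * σ * n * Real.sqrt (n + 1) * (Real.sqrt (Real.log (1 / s)) * D)
      < ∑ i ∈ Finset.range n, w i * δ i ω (u i ω)} ≤ ENNReal.ofReal s := by
  rcases hD.eq_or_lt with hD0 | hDpos
  · have : {ω | 4 * σ * n * Real.sqrt (n + 1) * (Real.sqrt (Real.log (1 / s)) * D)
      < ∑ i ∈ Finset.range n, w i * δ i ω (u i ω)} = ∅ := by
      apply Set.eq_empty_of_forall_notMem
      intro ω hω
      have hu0 : ∀ i, u i ω = 0 := fun i => by
        have := huD i ω
        rw [← hD0] at this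
        exact norm_le_zero_iff.1 this
      simp only [Set.mem_ofPred_eq, hu0, map_zero, mul_zero, Finset.sum_const_zero, ← hD0] at hω
      exact lt_irrefl _ hω
    rw [this]; simp
  · set ℓ := Real.sqrt (Real.log (1 / s)) with hℓ
    have hlog : 0 ≤ Real.log (1 / s) := Real.log_nonneg (by rw [le_div_iff₀ hs]; linarith)
    have hℓ0 : 0 ≤ ℓ := Real.sqrt_nonneg _
    have hℓ2 : ℓ ^ 2 = Real.log (1 / s) := Real.sq_sqrt hlog
    have hn0 : (1:ℝ) ≤ n := by exact_mod_cast hn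
    have hnp : (0:ℝ) < n := by linarith
    set R := Real.sqrt ((n:ℝ) + 1) with hR
    have hRp : 0 < R := Real.sqrt_pos.2 (by linarith)
    have hR2 : R ^ 2 = n + 1 := Real.sq_sqrt (by linarith)
    set l := ℓ / (n * D * σ * R) with hl
    have hl0 : 0 ≤ l := by positivity
    have ha : 0 ≤ ℓ / R := by positivity
    have hmain := aux_sum_mgf F hσ hu huD hδm hδi hδ0 hint hsg ha l n (w := w) (by
      intro i hi
      rw [abs_mul, abs_of_nonneg hl0]
      have h1 : l * |w i| * D * σ ≤ l * n * D * σ := by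
        have := hw i hi
        gcongr
      refine h1.trans (le_of_eq ?_)
      rw [hl]; field_simp) n le_rfl
    rcases hℓ0.eq_or_lt with hℓz | hℓp
    · have : s = 1 := by
        rw [← hℓz] at hℓ2
        have h1 : Real.log (1 / s) = 0 := by rw [← hℓ2]; ring
        rw [one_div, Real.log_inv, neg_eq_zero] at h1
        rcases Real.log_eq_zero.1 h1 with h | h | h <;> linarith
      rw [this]; simpa using prob_le_one
    have hlp : 0 < l := by positivity
    have hset : {ω | 4 * σ * n * R * (ℓ * D) < ∑ i ∈ Finset.range n, w i * δ i ω (u i ω)}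
      ⊆ {ω | 4 * ℓ ^ 2 < l * ∑ i ∈ Finset.range n, w i * δ i ω (u i ω)} := by
      intro ω hω
      have h1 := mul_lt_mul_of_pos_left hω hlp
      have h2 : l * (4 * σ * n * R * (ℓ * D)) = 4 * ℓ ^ 2 := by rw [hl]; field_simp
      rw [h2] at h1
      exact h1
    refine (measure_mono hset).trans ?_
    refine aux_markov (hmain.2.1 l) hmain.2.2 ?_
    have e : s = Real.exp (-ℓ ^ 2) := by
      rw [hℓ2, one_div, Real.log_inv, neg_neg, Real.exp_log hs]
    rw [e, ← Real.exp_add]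
    apply Real.exp_le_exp.2
    have h3 : (n:ℝ) * (2 * (ℓ / R) ^ 2) = 2 * ℓ ^ 2 * (n / (n + 1)) := by
      rw [div_pow, hR2]; ring
    have h4 : (n:ℝ) / (n + 1) ≤ 1 := by rw [div_le_one (by linarith)]; linarith
    rw [h3]
    nlinarith [sq_nonneg ℓ]

lemma aux_quad_tail (F : Filtration ℕ mΩ) {δ : ℕ → Ω → E →L[ℝ] ℝ}
    {σ : ℝ} (hδm : ∀ i, StronglyMeasurable[F (i + 1)] (δ i))
    (hint : ∀ i, Integrable (fun ω => Real.exp (‖δ i ω‖ ^ 2 / σ ^ 2)) Pr)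
    (hsg : ∀ i, ∀ᵐ ω ∂Pr, (Pr[fun ω' => Real.exp (‖δ i ω'‖ ^ 2 / σ ^ 2) | F i]) ω ≤ Real.exp 1)
    (n : ℕ) (hn : 1 ≤ n) {s : ℝ} (hs : 0 < s) :
    Pr {ω | (n:ℝ) * (1 + Real.log (1 / s)) < ∑ i ∈ Finset.range n, ‖δ i ω‖ ^ 2 / σ ^ 2}
      ≤ ENNReal.ofReal s := by
  have hn0 : (1:ℝ) ≤ n := by exact_mod_cast hn
  have hnp : (0:ℝ) < n := by linarith
  have hE : ∀ i, ∫ ω, Real.exp (‖δ i ω‖ ^ 2 / σ ^ 2) ∂Pr ≤ Real.exp 1 := by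
    intro i
    rw [← integral_condExp (F.le i)]
    have := integral_mono_ae (integrable_condExp (μ := Pr) (m := F i)
      (f := fun ω => Real.exp (‖δ i ω‖ ^ 2 / σ ^ 2)))
      (integrable_const (Real.exp 1)) (hsg i)
    simpa using this
  have hJ : ∀ ω, Real.exp ((1 / n) * ∑ i ∈ Finset.range n, ‖δ i ω‖ ^ 2 / σ ^ 2)
      ≤ (1 / n) * ∑ i ∈ Finset.range n, Real.exp (‖δ i ω‖ ^ 2 / σ ^ 2) := by
    intro ω
    have := convexOn_exp.map_sum_le (t := Finset.range n) (w := fun _ => 1 / (n:ℝ))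
      (p := fun i => ‖δ i ω‖ ^ 2 / σ ^ 2) (fun i _ => by positivity)
      (by simp; field_simp) (fun i _ => Set.mem_univ _)
    simpa only [smul_eq_mul, ← Finset.mul_sum] using this
  have hR : Integrable (fun ω => (1 / (n:ℝ)) * ∑ i ∈ Finset.range n,
      Real.exp (‖δ i ω‖ ^ 2 / σ ^ 2)) Pr :=
    (integrable_finsetSum _ fun i _ => hint i).const_mul _
  have hmeas : StronglyMeasurable
      (fun ω => (1 / (n:ℝ)) * ∑ i ∈ Finset.range n, ‖δ i ω‖ ^ 2 / σ ^ 2) := by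
    refine StronglyMeasurable.const_mul ?_ _
    refine Finset.stronglyMeasurable_fun_sum _ fun i _ => ?_
    have hc : Continuous (fun d : E →L[ℝ] ℝ => ‖d‖ ^ 2 / σ ^ 2) := by fun_prop
    exact hc.comp_stronglyMeasurable ((hδm i).mono (F.le _))
  have hi : Integrable
      (fun ω => Real.exp ((1 / n) * ∑ i ∈ Finset.range n, ‖δ i ω‖ ^ 2 / σ ^ 2)) Pr := by
    refine hR.mono' (Real.continuous_exp.comp_stronglyMeasurable hmeas).aestronglyMeasurable
      (ae_of_all _ fun ω => ?_)
    rw [Real.norm_of_nonneg (Real.exp_pos _).le]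
    exact hJ ω
  have hC : ∫ ω, Real.exp ((1 / n) * ∑ i ∈ Finset.range n, ‖δ i ω‖ ^ 2 / σ ^ 2) ∂Pr
      ≤ Real.exp 1 := by
    refine (integral_mono hi hR hJ).trans ?_
    rw [integral_const_mul, integral_finsetSum _ fun i _ => hint i]
    have h1 : ∑ i ∈ Finset.range n, ∫ ω, Real.exp (‖δ i ω‖ ^ 2 / σ ^ 2) ∂Pr
      ≤ ∑ i ∈ Finset.range n, Real.exp 1 := Finset.sum_le_sum fun i _ => hE i
    rw [Finset.sum_const, Finset.card_range, nsmul_eq_mul] at h1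
    rw [one_div, inv_mul_le_iff₀ hnp]
    exact h1
  have hset : {ω | (n:ℝ) * (1 + Real.log (1 / s)) < ∑ i ∈ Finset.range n, ‖δ i ω‖ ^ 2 / σ ^ 2}
      ⊆ {ω | 1 + Real.log (1 / s) < (1 / n) * ∑ i ∈ Finset.range n, ‖δ i ω‖ ^ 2 / σ ^ 2} := by
    intro ω hω
    rw [Set.mem_ofPred_eq] at hω ⊢
    rw [one_div (n:ℝ), lt_inv_mul_iff₀ hnp]
    exact hω
  refine (measure_mono hset).trans (aux_markov hi hC ?_)
  rw [Real.exp_add, Real.exp_log (by positivity)]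
  field_simp
  exact le_rfl

end Concentration


section Deterministic

set_option linter.unusedVariables false

lemma aux_avg {E : Type*} [NormedAddCommGroup E] [NormedSpace ℝ E] {X : Set E}
    (hX : Convex ℝ X) {g : E → EReal} (hg : IsCCP g) {xs xb : ℕ → E} {β : ℕ → ℝ}
    (hβ : ∀ t : ℕ, 1 ≤ t → β t = 2 / ((t : ℝ) + 1))
    (hx : ∀ t, 1 ≤ t → xs t ∈ X) (hgx : ∀ t, 1 ≤ t → g (xs (t+1)) ≠ ⊤)
    (h1 : xb 1 = xs 1)
    (hrec : ∀ t, 1 ≤ t → xb (t+1) = (1 - β t) • xb t + β t • xs (t+1)) :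
    ∀ t, 1 ≤ t → xb t ∈ X ∧ (1 - β t = 0 ∨ g (xb t) ≠ ⊤) := by
  intro t ht
  induction t, ht using Nat.le_induction with
  | base =>
    refine ⟨h1 ▸ hx 1 le_rfl, Or.inl ?_⟩
    rw [hβ 1 le_rfl]; norm_num
  | succ t ht ih =>
    have ht1 : (1:ℝ) ≤ t := by exact_mod_cast ht
    have hb0 : 0 ≤ β t := by rw [hβ t ht]; positivity
    have hb1 : 0 ≤ 1 - β t := by
      rw [hβ t ht, sub_nonneg, div_le_one (by linarith)]; linarith
    rw [hrec t ht]
    exact ⟨hX ih.1 (hx _ (by omega)) hb1 hb0 (by ring),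
      Or.inr (aux_econvex_real hg.1 hg.2.2.1 hb1 hb0 (by ring) ih.2 (hgx t ht)).1⟩

variable {𝕏 𝕐 : Type*} [NormedAddCommGroup 𝕏] [NormedSpace ℝ 𝕏]
  [NormedAddCommGroup 𝕐] [NormedSpace ℝ 𝕐]

/-- Real-valued primal-dual gap at a comparator. -/
noncomputable def rQ (f : 𝕏 → ℝ) (g : 𝕏 → EReal) (Φ : 𝕏 → 𝕐 → ℝ) (J : 𝕐 → EReal)
    (x : 𝕏) (y : 𝕐) (u : 𝕏) (v : 𝕐) : ℝ :=
  f u + (g u).toReal + Φ u y - (J y).toReal - (f x + (g x).toReal + Φ x v - (J v).toReal)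

lemma aux_onestep {X : Set 𝕏} {Y : Set 𝕐} (hXconv : Convex ℝ X) (hYconv : Convex ℝ Y)
    {L Lxx : ℝ}
    {f : 𝕏 → ℝ} {Df : 𝕏 → 𝕏 →L[ℝ] ℝ}
    (hf_cvx : ConvexOn ℝ X f)
    (hf_deriv : ∀ x ∈ X, HasFDerivAt f (Df x) x)
    (hf_smooth : ∀ x ∈ X, ∀ x' ∈ X, ‖Df x - Df x'‖ ≤ L * ‖x - x'‖)
    {g : 𝕏 → EReal} (hg : IsCCP g) {J : 𝕐 → EReal} (hJ : IsCCP J)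
    {Φ : 𝕏 → 𝕐 → ℝ} {DxΦ : 𝕏 → 𝕐 → 𝕏 →L[ℝ] ℝ} {DyΦ : 𝕏 → 𝕐 → 𝕐 →L[ℝ] ℝ}
    (hΦcvx : ∀ y ∈ Y, ConvexOn ℝ X (fun x => Φ x y))
    (hΦccv : ∀ x ∈ X, ConcaveOn ℝ Y (Φ x))
    (hΦdx : ∀ x ∈ X, ∀ y ∈ Y, HasFDerivAt (fun x' => Φ x' y) (DxΦ x y) x)
    (hΦdy : ∀ x ∈ X, ∀ y ∈ Y, HasFDerivAt (fun y' => Φ x y') (DyΦ x y) y)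
    (hΦxx : ∀ x ∈ X, ∀ x' ∈ X, ∀ y ∈ Y, ‖DxΦ x y - DxΦ x' y‖ ≤ Lxx * ‖x - x'‖)
    {x xc xn xbar : 𝕏} {y yn ybar : 𝕐} {b : ℝ} (hb0 : 0 ≤ b) (hb1 : 0 ≤ 1 - b)
    (hx : x ∈ X) (hxc : xc ∈ X) (hxn : xn ∈ X) (hxbar : xbar ∈ X)
    (hy : y ∈ Y) (hyn : yn ∈ Y) (hybar : ybar ∈ Y)
    (hgb : 1 - b = 0 ∨ g xbar ≠ ⊤) (hgn : g xn ≠ ⊤)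
    (hJb : 1 - b = 0 ∨ J ybar ≠ ⊤) (hJn : J yn ≠ ⊤) :
    rQ f g Φ J x y ((1 - b) • xbar + b • xn) ((1 - b) • ybar + b • yn)
      ≤ (1 - b) * rQ f g Φ J x y xbar ybar
        + b * (Df ((1 - b) • xbar + b • xc) (xn - x) + (g xn).toReal - (g x).toReal
          + (J yn).toReal - (J y).toReal + DyΦ xn yn (y - yn) + DxΦ xc yn (xn - x)
          + (Lxx / 2 + b * L / 2) * ‖xn - xc‖ ^ 2) := by
  set xt := (1 - b) • xbar + b • xc with hxt
  set xb' := (1 - b) • xbar + b • xn with hxb'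
  set yb' := (1 - b) • ybar + b • yn with hyb'
  have hxtX : xt ∈ X := hXconv hxbar hxc hb1 hb0 (by ring)
  have hxbX : xb' ∈ X := hXconv hxbar hxn hb1 hb0 (by ring)
  have g1 := (aux_econvex_real hg.1 hg.2.2.1 hb1 hb0 (by ring) hgb hgn).2
  have J1 := (aux_econvex_real hJ.1 hJ.2.2.1 hb1 hb0 (by ring) hJb hJn).2
  have P1 := (hΦcvx y hy).2 hxbar hxn hb1 hb0 (by ring)
  have P2 := (hΦccv x hx).2 hybar hyn hb1 hb0 (by ring)
  have f1 := aux_descent hXconv hxtX hxbX hf_deriv hf_smooth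
  have f2 := aux_convex_grad hf_cvx hxtX hxbar (hf_deriv xt hxtX)
  have f3 := aux_convex_grad hf_cvx hxtX hx (hf_deriv xt hxtX)
  have e1 : xb' - xt = b • (xn - xc) := by rw [hxb', hxt]; module
  have e1n : ‖xb' - xt‖ = b * ‖xn - xc‖ := by
    rw [e1, norm_smul, Real.norm_of_nonneg hb0]
  have e2 : xb' - xt = (1 - b) • (xbar - xt) + b • ((xn - x) + (x - xt)) := by
    rw [hxb']; module
  have e3 : Df xt (xb' - xt)
      = (1 - b) * Df xt (xbar - xt) + b * (Df xt (xn - x) + Df xt (x - xt)) := by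
    rw [e2]; simp only [map_add, map_smul, smul_eq_mul]
  rw [e3, e1n] at f1
  have d1 := aux_descent (f := fun x' => Φ x' yn) (Df := fun x' => DxΦ x' yn) hXconv hxc hxn
    (fun x hx => hΦdx x hx yn hyn) (fun x hx x' hx' => hΦxx x hx x' hx' yn hyn)
  have d2 := aux_convex_grad (hΦcvx yn hyn) hxc hx (hΦdx xc hxc yn hyn)
  have d3 := aux_convex_grad (f := fun v => -Φ xn v) (f' := -DyΦ xn yn) (hΦccv xn hxn).neg hyn hy
    (hΦdy xn hxn yn hyn).neg
  have e4 : DxΦ xc yn (xn - xc) = DxΦ xc yn (xn - x) + DxΦ xc yn (x - xc) := by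
    rw [← map_add]; congr 1; abel
  have e5 : (-DyΦ xn yn) (y - yn) = - DyΦ xn yn (y - yn) := rfl
  rw [e5] at d3
  simp only [smul_eq_mul] at P1 P2
  rw [e4] at d1
  -- assemble
  have hF : f xb' ≤ (1 - b) * f xbar + b * (f x + Df xt (xn - x))
      + L / 2 * (b * ‖xn - xc‖) ^ 2 := by
    have := mul_le_mul_of_nonneg_left f2 hb1
    have := mul_le_mul_of_nonneg_left f3 hb0
    linarith
  have hP : Φ xn y - Φ x yn ≤ DyΦ xn yn (y - yn) + DxΦ xc yn (xn - x)
      + Lxx / 2 * ‖xn - xc‖ ^ 2 := by linarith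
  have hP' := mul_le_mul_of_nonneg_left hP hb0
  unfold rQ
  nlinarith

lemma aux_amgm {t k d c : ℝ} (ht : 0 ≤ t) (hk : 0 < k) :
    t * d * c ≤ k * (t * Real.sqrt t) * c ^ 2 + Real.sqrt t * d ^ 2 / (4 * k) := by
  have hr : 0 ≤ Real.sqrt t := Real.sqrt_nonneg t
  have h2 : Real.sqrt t ^ 2 = t := Real.sq_sqrt ht
  set r := Real.sqrt t
  have e : k * (t * r) * c ^ 2 + r * d ^ 2 / (4 * k) - t * d * c = r * k * (r * c - d / (2 * k)) ^ 2 := by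
    rw [← h2]; field_simp; ring
  have : 0 ≤ r * k * (r * c - d / (2 * k)) ^ 2 := by positivity
  linarith

/-- Numerical absorption inequality of one step (`t = m+1`). -/
lemma aux_num {m L Lxx Lyx Lyy ρ ρ' σy σΦ σf a c a' c' d d' p r : ℝ} (hm : 0 ≤ m)
    (hL : 0 ≤ L) (hLxx : 0 ≤ Lxx) (hLyx : 0 ≤ Lyx) (hLyy : 0 ≤ Lyy)
    (hρ : 0 < ρ) (hρ' : 0 < ρ') (hσy : 0 < σy) (hσΦ : 0 < σΦ) (hσf : 0 < σf)
    (hd : 0 ≤ d) (hc : 0 ≤ c) :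
    m * (Lyx * a' + Lyy * c') * c + m * (d + d') * c + (m + 1) * (p + r) * a
      + (L + Lxx * (m + 1) / 2) * a ^ 2
      + (m + 1) / 2 * (Lyx * a ^ 2 + Lyy * c ^ 2)
      ≤ m / 2 * (Lyx * a' ^ 2 + Lyy * c' ^ 2) + Real.sqrt m * d' ^ 2 / (16 * (ρ * σy))
      + Real.sqrt (m + 1) * d ^ 2 / (16 * (ρ * σy))
      + Real.sqrt (m + 1) / (4 * ρ') * (p ^ 2 / σΦ + r ^ 2 / σf)
      + (2 * L + (Lxx + Lyx) * (m + 1)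
        + ρ' * (σΦ + σf) * ((m + 1) * Real.sqrt (m + 1))) * a ^ 2
      + 8 * ((Lyx + Lyy) * (m + 1) + ρ * σy * ((m + 1) * Real.sqrt (m + 1))) * c ^ 2 := by
  have hk : 0 < 4 * (ρ * σy) := by positivity
  have h1 := aux_amgm (t := m + 1) (k := 4 * (ρ * σy)) (d := d) (c := c) (by linarith) hk
  have h2 := aux_amgm (t := m) (k := 4 * (ρ * σy)) (d := d') (c := c) hm hk
  have h3 := aux_amgm (t := m + 1) (k := ρ' * σΦ) (d := p) (c := a) (by linarith) (by positivity)
  have h4 := aux_amgm (t := m + 1) (k := ρ' * σf) (d := r) (c := a) (by linarith) (by positivity)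
  have h5 : m * Real.sqrt m ≤ (m + 1) * Real.sqrt (m + 1) := by
    have := Real.sqrt_le_sqrt (show m ≤ m + 1 by linarith)
    have := Real.sqrt_nonneg m
    nlinarith
  have h6 : 4 * (ρ * σy) * (m * Real.sqrt m) * c ^ 2
      ≤ 4 * (ρ * σy) * ((m + 1) * Real.sqrt (m + 1)) * c ^ 2 := by gcongr
  have h7 : m * d * c ≤ (m + 1) * d * c := by gcongr; linarith
  have h8 : m * Lyx * (a' * c) ≤ m * Lyx * ((a' ^ 2 + c ^ 2) / 2) := by
    apply mul_le_mul_of_nonneg_left _ (by positivity); nlinarith [sq_nonneg (a' - c)]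
  have h9 : m * Lyy * (c' * c) ≤ m * Lyy * ((c' ^ 2 + c ^ 2) / 2) := by
    apply mul_le_mul_of_nonneg_left _ (by positivity); nlinarith [sq_nonneg (c' - c)]
  have e3 : Real.sqrt (m + 1) / (4 * ρ') * (p ^ 2 / σΦ + r ^ 2 / σf)
    = Real.sqrt (m + 1) * p ^ 2 / (4 * (ρ' * σΦ)) + Real.sqrt (m + 1) * r ^ 2 / (4 * (ρ' * σf)) := by
    field_simp
  have e4 : 4 * (4 * (ρ * σy)) = 16 * (ρ * σy) := by ring
  rw [e4] at h1 h2
  rw [e3]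
  have n1 : 0 ≤ L * a ^ 2 := by positivity
  have n2 : 0 ≤ Lxx * (m + 1) * a ^ 2 := by positivity
  have n3 : 0 ≤ Lyx * (m + 1) * a ^ 2 := by positivity
  have n4 : 0 ≤ Lyx * m * c ^ 2 := by positivity
  have n5 : 0 ≤ Lyy * m * c ^ 2 := by positivity
  have n6 : 0 ≤ Lyx * c ^ 2 := by positivity
  have n7 : 0 ≤ Lyy * c ^ 2 := by positivity
  linarith

/-- Boundary absorption. -/
lemma aux_num_bd {n Lyx Lyy ρ σy a c d r : ℝ} (hn : 0 ≤ n)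
    (hLyx : 0 ≤ Lyx) (hLyy : 0 ≤ Lyy) (hρ : 0 < ρ) (hσy : 0 < σy) :
    n * (Lyx * a + Lyy * c) * r + n * d * r
      ≤ n / 2 * (Lyx * a ^ 2 + Lyy * c ^ 2) + Real.sqrt n * d ^ 2 / (16 * (ρ * σy))
        + 8 * ((Lyx + Lyy) * n + ρ * σy * (n * Real.sqrt n)) * r ^ 2 := by
  have h1 := aux_amgm (t := n) (k := 4 * (ρ * σy)) (d := d) (c := r) hn (by positivity)
  have h8 : n * Lyx * (a * r) ≤ n * Lyx * ((a ^ 2 + r ^ 2) / 2) := by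
    apply mul_le_mul_of_nonneg_left _ (by positivity); nlinarith [sq_nonneg (a - r)]
  have h9 : n * Lyy * (c * r) ≤ n * Lyy * ((c ^ 2 + r ^ 2) / 2) := by
    apply mul_le_mul_of_nonneg_left _ (by positivity); nlinarith [sq_nonneg (c - r)]
  have e4 : 4 * (4 * (ρ * σy)) = 16 * (ρ * σy) := by ring
  rw [e4] at h1
  have hs := Real.sqrt_nonneg n
  have n4 : 0 ≤ n * Lyx * r ^ 2 := by positivity
  have n5 : 0 ≤ n * Lyy * r ^ 2 := by positivity
  have n6 : 0 ≤ ρ * σy * (n * Real.sqrt n) * r ^ 2 := by positivity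
  linarith

end Deterministic


section Potential

variable {𝕏 𝕐 : Type*} [NormedAddCommGroup 𝕏] [NormedSpace ℝ 𝕏]
  [NormedAddCommGroup 𝕐] [NormedSpace ℝ 𝕐]

/-- The stochastic remainder. -/
noncomputable def rN (ρ ρ' σy σΦ σf : ℝ) (xs : ℕ → 𝕏) (ys : ℕ → 𝕐)
    (δ : ℕ → 𝕐 →L[ℝ] ℝ) (p r : ℕ → 𝕏 →L[ℝ] ℝ) (x : 𝕏) (y : 𝕐) (n : ℕ) : ℝ :=
  ∑ i ∈ Finset.range n, (((i:ℝ) + 1) * (p (i+1) + r (i+1)) (x - xs (i+1))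
    + Real.sqrt ((i:ℝ) + 1) / (4 * ρ') * (‖p (i+1)‖ ^ 2 / σΦ + ‖r (i+1)‖ ^ 2 / σf)
    + (i:ℝ) * δ (i+1) (ys (i+1) - y)
    + Real.sqrt ((i:ℝ) + 1) * ‖δ (i+1)‖ ^ 2 / (8 * (ρ * σy)))

lemma aux_potential {L Lxx Lyx Lyy ρ ρ' σy σΦ σf OX OY : ℝ}
    (hL : 0 ≤ L) (hLxx : 0 ≤ Lxx) (hLyx : 0 ≤ Lyx) (hLyy : 0 ≤ Lyy)
    (hρ : 0 < ρ) (hρ' : 0 < ρ') (hσy : 0 < σy) (hσΦ : 0 < σΦ) (hσf : 0 < σf)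
    {xs : ℕ → 𝕏} {ys : ℕ → 𝕐} {q δ s : ℕ → 𝕐 →L[ℝ] ℝ} {p r : ℕ → 𝕏 →L[ℝ] ℝ}
    {x : 𝕏} {y : 𝕐} {Q BX BY : ℕ → ℝ} {A C : ℕ → ℝ}
    (hA : ∀ n : ℕ, A n = 2 * (2 * L + (Lxx + Lyx) * n + ρ' * (σΦ + σf) * (n * Real.sqrt n)))
    (hC : ∀ n : ℕ, C n = 16 * ((Lyx + Lyy) * n + ρ * σy * (n * Real.sqrt n)))
    (hBX0 : ∀ n : ℕ, 0 ≤ BX (n+1)) (hBX : ∀ n : ℕ, BX (n+1) ≤ OX)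
    (hBY0 : ∀ n : ℕ, 1 / 2 * ‖y - ys (n+1)‖ ^ 2 ≤ BY (n+1)) (hBY : ∀ n : ℕ, BY (n+1) ≤ OY)
    (hs : ∀ (i : ℕ) (v : 𝕐), ((i:ℝ) + 1) * s (i+1) v = ((i:ℝ)+1) * (q (i+1) v + δ (i+1) v)
      + i * ((q (i+1) v + δ (i+1) v) - (q i v + δ i v)))
    (hq : ∀ i : ℕ, 1 ≤ i → ‖q (i+1) - q i‖ ≤ Lyx * ‖xs (i+1) - xs i‖ + Lyy * ‖ys (i+1) - ys i‖)
    (hstep : ∀ i : ℕ, ((i:ℝ)+1) * (i + 2) / 2 * Q (i+2) ≤ (i:ℝ) * (i+1) / 2 * Q (i+1)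
      + A (i+1) * (BX (i+1) - BX (i+2) - 1 / 2 * ‖xs (i+2) - xs (i+1)‖ ^ 2)
      + C (i+1) * (BY (i+1) - BY (i+2) - 1 / 2 * ‖ys (i+2) - ys (i+1)‖ ^ 2)
      + ((i:ℝ)+1) * (s (i+1) - q (i+2)) (ys (i+2) - y)
      + ((i:ℝ)+1) * (p (i+1) + r (i+1)) (x - xs (i+2))
      + (L + Lxx * ((i:ℝ)+1) / 2) * ‖xs (i+2) - xs (i+1)‖ ^ 2) (n : ℕ) :
    (n:ℝ) * (n+1) / 2 * Q (n+1) ≤ A n * OX + C n * OY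
      + rN ρ ρ' σy σΦ σf xs ys δ p r x y n := by
  have hqi : ∀ (i : ℕ) (v : 𝕐), (i:ℝ) * |(q (i+1) - q i) v|
      ≤ i * (Lyx * ‖xs (i+1) - xs i‖ + Lyy * ‖ys (i+1) - ys i‖) * ‖v‖ := by
    intro i v
    rcases Nat.eq_zero_or_pos i with h | h
    · subst h; simp
    · have := (q (i+1) - q i).le_of_opNorm_le (hq i h) v
      rw [Real.norm_eq_abs] at this
      rw [mul_assoc]
      exact mul_le_mul_of_nonneg_left this (Nat.cast_nonneg i)
  have key : ∀ n : ℕ, (n:ℝ) * (n+1) / 2 * Q (n+1) + A n * BX (n+1) + C n * BY (n+1)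
      + ((n:ℝ) * (q (n+1) - q n) (ys (n+1) - y) - n * δ n (ys (n+1) - y))
      + (n:ℝ) / 2 * (Lyx * ‖xs (n+1) - xs n‖ ^ 2 + Lyy * ‖ys (n+1) - ys n‖ ^ 2)
      + Real.sqrt n * ‖δ n‖ ^ 2 / (16 * (ρ * σy))
      ≤ A n * OX + C n * OY + rN ρ ρ' σy σΦ σf xs ys δ p r x y n := by
    intro n
    induction n with
    | zero =>
      simp only [rN, Finset.range_zero, Finset.sum_empty, hA, hC]
      have := mul_le_mul_of_nonneg_left (hBX 0) hL
      simp; nlinarith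
    | succ i ih =>
      have st := hstep i
      have num := aux_num (m := (i:ℝ)) (L := L) (Lxx := Lxx) (Lyx := Lyx) (Lyy := Lyy)
        (ρ := ρ) (ρ' := ρ') (σy := σy) (σΦ := σΦ) (σf := σf)
        (a := ‖xs (i+2) - xs (i+1)‖) (c := ‖ys (i+2) - ys (i+1)‖)
        (a' := ‖xs (i+1) - xs i‖) (c' := ‖ys (i+1) - ys i‖) (d := ‖δ (i+1)‖) (d' := ‖δ i‖)
        (p := ‖p (i+1)‖) (r := ‖r (i+1)‖) (Nat.cast_nonneg i) hL hLxx hLyx hLyy hρ hρ' hσy hσΦ hσf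
        (norm_nonneg _) (norm_nonneg _)
      have hN : rN ρ ρ' σy σΦ σf xs ys δ p r x y (i+1) = rN ρ ρ' σy σΦ σf xs ys δ p r x y i
        + (((i:ℝ) + 1) * (p (i+1) + r (i+1)) (x - xs (i+1))
          + Real.sqrt ((i:ℝ) + 1) / (4 * ρ') * (‖p (i+1)‖ ^ 2 / σΦ + ‖r (i+1)‖ ^ 2 / σf)
          + (i:ℝ) * δ (i+1) (ys (i+1) - y)
          + Real.sqrt ((i:ℝ) + 1) * ‖δ (i+1)‖ ^ 2 / (8 * (ρ * σy))) := by
        unfold rN; rw [Finset.sum_range_succ]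
      have hk : Real.sqrt ((i:ℝ) + 1) * ‖δ (i+1)‖ ^ 2 / (8 * (ρ * σy))
        = 2 * (Real.sqrt ((i:ℝ) + 1) * ‖δ (i+1)‖ ^ 2 / (16 * (ρ * σy))) := by
        field_simp; ring
      rw [hk] at hN
      have hh : (i:ℝ) * Real.sqrt i ≤ ((i:ℝ)+1) * Real.sqrt ((i:ℝ)+1) := by
        gcongr <;> linarith
      have hA1 : A i ≤ A (i+1) := by
        rw [hA, hA]; push_cast; gcongr <;> linarith
      have hC1 : C i ≤ C (i+1) := by
        rw [hC, hC]; push_cast; gcongr <;> linarith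
      have a1 := mul_le_mul_of_nonneg_left (hBX i) (sub_nonneg.2 hA1)
      have c1 := mul_le_mul_of_nonneg_left (hBY i) (sub_nonneg.2 hC1)
      have eA := hA (i+1)
      have eC := hC (i+1)
      push_cast at eA eC
      have e1 : ys (i+2) - y = (ys (i+2) - ys (i+1)) + (ys (i+1) - y) := by abel
      have sv := hs i (ys (i+2) - y)
      have s1 : (s (i+1) - q (i+2)) (ys (i+2) - y) = s (i+1) (ys (i+2) - y) - q (i+2) (ys (i+2) - y) := rfl
      have s2 : (q (i+2) - q (i+1)) (ys (i+2) - y) = q (i+2) (ys (i+2) - y) - q (i+1) (ys (i+2) - y) := rfl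
      have s3 : (q (i+1) - q i) (ys (i+1) - y) = q (i+1) (ys (i+1) - y) - q i (ys (i+1) - y) := rfl
      have s4 : (q (i+1) - q i) (ys (i+2) - ys (i+1)) = q (i+1) (ys (i+2) - ys (i+1)) - q i (ys (i+2) - ys (i+1)) := rfl
      have hident : ((i:ℝ)+1) * (s (i+1) - q (i+2)) (ys (i+2) - y)
          = - (((i:ℝ)+1) * (q (i+2) - q (i+1)) (ys (i+2) - y) - ((i:ℝ)+1) * δ (i+1) (ys (i+2) - y))
            + ((i:ℝ) * (q (i+1) - q i) (ys (i+1) - y) - i * δ i (ys (i+1) - y))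
            + (i:ℝ) * (q (i+1) - q i) (ys (i+2) - ys (i+1))
            + (i:ℝ) * (δ (i+1) (ys (i+2) - ys (i+1)) - δ i (ys (i+2) - ys (i+1)))
            + (i:ℝ) * δ (i+1) (ys (i+1) - y) := by
        rw [s1, s2, s3, s4, mul_sub, sv, e1]
        simp only [map_add]
        ring
      have b1 : (i:ℝ) * (q (i+1) - q i) (ys (i+2) - ys (i+1))
          ≤ i * (Lyx * ‖xs (i+1) - xs i‖ + Lyy * ‖ys (i+1) - ys i‖) * ‖ys (i+2) - ys (i+1)‖ :=
        le_trans (mul_le_mul_of_nonneg_left (le_abs_self _) (Nat.cast_nonneg i)) (hqi i _)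
      have b2 : (i:ℝ) * (δ (i+1) (ys (i+2) - ys (i+1)) - δ i (ys (i+2) - ys (i+1)))
          ≤ i * (‖δ (i+1)‖ + ‖δ i‖) * ‖ys (i+2) - ys (i+1)‖ := by
        rw [mul_assoc]
        apply mul_le_mul_of_nonneg_left _ (Nat.cast_nonneg i)
        have u1 := (δ (i+1)).le_opNorm (ys (i+2) - ys (i+1))
        have u2 := (δ i).le_opNorm (ys (i+2) - ys (i+1))
        rw [Real.norm_eq_abs] at u1 u2
        have := le_abs_self (δ (i+1) (ys (i+2) - ys (i+1)))
        have := neg_abs_le (δ i (ys (i+2) - ys (i+1)))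
        linarith
      have b3 : ((i:ℝ)+1) * (p (i+1) + r (i+1)) (x - xs (i+2))
          ≤ ((i:ℝ)+1) * (p (i+1) + r (i+1)) (x - xs (i+1))
            + ((i:ℝ)+1) * (‖p (i+1)‖ + ‖r (i+1)‖) * ‖xs (i+2) - xs (i+1)‖ := by
        rw [mul_assoc, ← mul_add]
        apply mul_le_mul_of_nonneg_left _ (by positivity)
        have : x - xs (i+2) = (x - xs (i+1)) - (xs (i+2) - xs (i+1)) := by abel
        rw [this, map_sub]
        have u1 := (p (i+1) + r (i+1)).le_of_opNorm_le (norm_add_le _ _) (xs (i+2) - xs (i+1))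
        rw [Real.norm_eq_abs] at u1
        have := neg_abs_le ((p (i+1) + r (i+1)) (xs (i+2) - xs (i+1)))
        linarith
      rw [hN]
      have e3 : i + 1 + 1 = i + 2 := rfl
      simp only [Nat.cast_add, Nat.cast_one, e3]
      rw [hident] at st
      have eA2 : A (i+1) * (BX (i+1) - BX (i+2) - 1 / 2 * ‖xs (i+2) - xs (i+1)‖ ^ 2)
        = A (i+1) * BX (i+1) - A (i+1) * BX (i+2) - (2 * L + (Lxx + Lyx) * (i + 1)
          + ρ' * (σΦ + σf) * ((i + 1) * Real.sqrt (i + 1))) * ‖xs (i+2) - xs (i+1)‖ ^ 2 := by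
        rw [eA]; ring
      have eC2 : C (i+1) * (BY (i+1) - BY (i+2) - 1 / 2 * ‖ys (i+2) - ys (i+1)‖ ^ 2)
        = C (i+1) * BY (i+1) - C (i+1) * BY (i+2) - 8 * ((Lyx + Lyy) * (i + 1)
          + ρ * σy * ((i + 1) * Real.sqrt (i + 1))) * ‖ys (i+2) - ys (i+1)‖ ^ 2 := by
        rw [eC]; ring
      rw [eA2, eC2] at st
      have e2 : ((i:ℝ) + 1 + 1) = i + 2 := by ring
      rw [e2]
      linarith
  have k := key n
  have bd := aux_num_bd (n := (n:ℝ)) (Lyx := Lyx) (Lyy := Lyy) (ρ := ρ) (σy := σy)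
    (a := ‖xs (n+1) - xs n‖) (c := ‖ys (n+1) - ys n‖) (d := ‖δ n‖) (r := ‖ys (n+1) - y‖)
    (Nat.cast_nonneg n) hLyx hLyy hρ hσy
  have hAn : 0 ≤ A n * BX (n+1) := mul_nonneg (by rw [hA]; positivity) (hBX0 n)
  have hCn : 8 * ((Lyx + Lyy) * n + ρ * σy * (n * Real.sqrt n)) * ‖ys (n+1) - y‖ ^ 2
      ≤ C n * BY (n+1) := by
    have h0 : 0 ≤ C n := by rw [hC]; positivity
    have := mul_le_mul_of_nonneg_left (hBY0 n) h0
    rw [norm_sub_rev y] at this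
    refine le_trans (le_of_eq ?_) this
    rw [hC]; ring
  have g1 : -((n:ℝ) * (q (n+1) - q n) (ys (n+1) - y))
      ≤ n * (Lyx * ‖xs (n+1) - xs n‖ + Lyy * ‖ys (n+1) - ys n‖) * ‖ys (n+1) - y‖ := by
    refine le_trans ?_ (hqi n _)
    have := mul_le_mul_of_nonneg_left (neg_abs_le ((q (n+1) - q n) (ys (n+1) - y)))
      (Nat.cast_nonneg (α := ℝ) n)
    linarith
  have g2 : (n:ℝ) * δ n (ys (n+1) - y) ≤ n * ‖δ n‖ * ‖ys (n+1) - y‖ := by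
    rw [mul_assoc]
    apply mul_le_mul_of_nonneg_left _ (Nat.cast_nonneg n)
    exact le_trans (le_abs_self _) ((δ n).le_opNorm _)
  linarith

lemma aux_det {X : Set 𝕏} {Y : Set 𝕐} (hXconv : Convex ℝ X) (hYconv : Convex ℝ Y)
    {L Lxx Lyx Lyy : ℝ} (hL : 0 ≤ L) (hLxx : 0 ≤ Lxx) (hLyx : 0 ≤ Lyx) (hLyy : 0 ≤ Lyy)
    {f : 𝕏 → ℝ} {Df : 𝕏 → 𝕏 →L[ℝ] ℝ}
    (hf_cvx : ConvexOn ℝ X f)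
    (hf_deriv : ∀ x ∈ X, HasFDerivAt f (Df x) x)
    (hf_smooth : ∀ x ∈ X, ∀ x' ∈ X, ‖Df x - Df x'‖ ≤ L * ‖x - x'‖)
    {g : 𝕏 → EReal} (hg : IsCCP g) (hgX : (edom g ∩ X).Nonempty)
    {J : 𝕐 → EReal} (hJ : IsCCP J) (hJY : (edom J ∩ Y).Nonempty)
    {Φ : 𝕏 → 𝕐 → ℝ} {DxΦ : 𝕏 → 𝕐 → 𝕏 →L[ℝ] ℝ} {DyΦ : 𝕏 → 𝕐 → 𝕐 →L[ℝ] ℝ}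
    (hΦcvx : ∀ y ∈ Y, ConvexOn ℝ X (fun x => Φ x y))
    (hΦccv : ∀ x ∈ X, ConcaveOn ℝ Y (Φ x))
    (hΦdx : ∀ x ∈ X, ∀ y ∈ Y, HasFDerivAt (fun x' => Φ x' y) (DxΦ x y) x)
    (hΦdy : ∀ x ∈ X, ∀ y ∈ Y, HasFDerivAt (fun y' => Φ x y') (DyΦ x y) y)
    (hΦxx : ∀ x ∈ X, ∀ x' ∈ X, ∀ y ∈ Y, ‖DxΦ x y - DxΦ x' y‖ ≤ Lxx * ‖x - x'‖)
    (hΦyx2 : ∀ x ∈ X, ∀ x' ∈ X, ∀ y ∈ Y, ‖DyΦ x y - DyΦ x' y‖ ≤ Lyx * ‖x - x'‖)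
    (hΦyy : ∀ x ∈ X, ∀ y ∈ Y, ∀ y' ∈ Y, ‖DyΦ x y - DyΦ x y'‖ ≤ Lyy * ‖y - y'‖)
    {dgfX : 𝕏 → EReal} {DdgfX : 𝕏 → 𝕏 →L[ℝ] ℝ} {dgfY : 𝕐 → EReal} {DdgfY : 𝕐 → 𝕐 →L[ℝ] ℝ}
    {ΩX ΩY : ℝ} (hdX : DGFData dgfX DdgfX X ΩX) (hdY : DGFData dgfY DdgfY Y ΩY)
    {θ β α τ : ℕ → ℝ} {xs xb xt : ℕ → 𝕏} {ys yb : ℕ → 𝕐} {s : ℕ → 𝕐 →L[ℝ] ℝ}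
    {Gf GxΦ : ℕ → 𝕏 →L[ℝ] ℝ} {GyΦ : ℕ → 𝕐 →L[ℝ] ℝ}
    (hinit_x : xs 1 ∈ X ∩ interior (edom dgfX))
    (hinit_y : ys 1 ∈ Y ∩ interior (edom dgfY))
    (hinit_xb : xb 1 = xs 1) (hinit_yb : yb 1 = ys 1) (hinit_s : s 1 = GyΦ 1)
    (hstep_y : ∀ t, 1 ≤ t → ys (t+1) ∈ Y ∩ interior (edom dgfY) ∧
      ∀ y ∈ Y,
        J (ys (t+1)) + ((-((s t) (ys (t+1) - ys t)) : ℝ) : EReal)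
            + (((α t)⁻¹ : ℝ) : EReal) * Dbreg dgfY DdgfY (ys (t+1)) (ys t)
          ≤ J y + ((-((s t) (y - ys t)) : ℝ) : EReal)
            + (((α t)⁻¹ : ℝ) : EReal) * Dbreg dgfY DdgfY y (ys t))
    (hstep_xt : ∀ t, 1 ≤ t → xt (t+1) = (1 - β t) • xb t + β t • xs t)
    (hstep_x : ∀ t, 1 ≤ t → xs (t+1) ∈ X ∩ interior (edom dgfX) ∧
      ∀ x ∈ X,
        g (xs (t+1)) + (((GxΦ t + Gf t) (xs (t+1) - xs t) : ℝ) : EReal)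
            + (((τ t)⁻¹ : ℝ) : EReal) * Dbreg dgfX DdgfX (xs (t+1)) (xs t)
          ≤ g x + (((GxΦ t + Gf t) (x - xs t) : ℝ) : EReal)
            + (((τ t)⁻¹ : ℝ) : EReal) * Dbreg dgfX DdgfX x (xs t))
    (hstep_s : ∀ t, 1 ≤ t →
      s (t+1) = (1 + θ (t+1)) • GyΦ (t+1) - θ (t+1) • GyΦ t)
    (hstep_xb : ∀ t, 1 ≤ t → xb (t+1) = (1 - β t) • xb t + β t • xs (t+1))
    (hstep_yb : ∀ t, 1 ≤ t → yb (t+1) = (1 - β t) • yb t + β t • ys (t+1))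
    {δyΦ : ℕ → 𝕐 →L[ℝ] ℝ} {δxΦ δxf : ℕ → 𝕏 →L[ℝ] ℝ}
    (hδyΦ : ∀ t, δyΦ t = GyΦ t - DyΦ (xs t) (ys t))
    (hδxΦ : ∀ t, δxΦ t = GxΦ t - DxΦ (xs t) (ys (t+1)))
    (hδxf : ∀ t, δxf t = Gf t - Df (xt (t+1)))
    {σyΦ σxΦ σxf : ℝ} (hσy : 0 < σyΦ) (hσxΦ : 0 < σxΦ) (hσxf : 0 < σxf)
    {ρ ρ' : ℝ} (hρ : 0 < ρ) (hρ' : 0 < ρ')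
    (hθ : ∀ t : ℕ, 1 ≤ t → θ t = ((t : ℝ) - 1) / t)
    (hβ : ∀ t : ℕ, 1 ≤ t → β t = 2 / ((t : ℝ) + 1))
    (hα : ∀ t : ℕ, 1 ≤ t →
      α t = 1 / (16 * (Lyx + Lyy + ρ * σyΦ * Real.sqrt t)))
    (hτ : ∀ t : ℕ, 1 ≤ t →
      τ t = (t : ℝ) / (2 * (2 * L + (Lxx + Lyx) * t
        + ρ' * (σxΦ + σxf) * (t : ℝ) ^ ((3 : ℝ) / 2)))) :
    (∀ n : ℕ, 1 ≤ n → xb (n+1) ∈ X ∧ yb (n+1) ∈ Y ∧ g (xb (n+1)) ≠ ⊤ ∧ J (yb (n+1)) ≠ ⊤) ∧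
    ∀ x ∈ X, g x ≠ ⊤ → ∀ y ∈ Y, J y ≠ ⊤ → ∀ n : ℕ,
      (n:ℝ) * (n+1) / 2 * rQ f g Φ J x y (xb (n+1)) (yb (n+1))
        ≤ 2 * (2 * L + (Lxx + Lyx) * n + ρ' * (σxΦ + σxf) * (n * Real.sqrt n)) * ΩX
          + 16 * ((Lyx + Lyy) * n + ρ * σyΦ * (n * Real.sqrt n)) * ΩY
          + rN ρ ρ' σyΦ σxΦ σxf xs ys δyΦ δxΦ δxf x y n := by
  have hxs : ∀ t, 1 ≤ t → xs t ∈ X ∩ interior (edom dgfX) := by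
    intro t ht
    obtain ⟨k, rfl⟩ := Nat.exists_eq_add_of_le' ht
    rcases Nat.eq_zero_or_pos k with h | h
    · subst h; exact hinit_x
    · exact (hstep_x k h).1
  have hys : ∀ t, 1 ≤ t → ys t ∈ Y ∩ interior (edom dgfY) := by
    intro t ht
    obtain ⟨k, rfl⟩ := Nat.exists_eq_add_of_le' ht
    rcases Nat.eq_zero_or_pos k with h | h
    · subst h; exact hinit_y
    · exact (hstep_y k h).1
  have px := fun t (ht : 1 ≤ t) => aux_prox hdX hXconv hg hgX (hxs t ht) (hstep_x t ht).1
    (GxΦ t + Gf t) (η := (τ t)⁻¹) (hstep_x t ht).2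
  have py := fun t (ht : 1 ≤ t) => aux_prox hdY hYconv hJ hJY (hys t ht) (hstep_y t ht).1
    (- s t) (η := (α t)⁻¹) (hstep_y t ht).2
  have ax := aux_avg hXconv hg hβ (fun t ht => (hxs t ht).1) (fun t ht => (px t ht).1)
    hinit_xb hstep_xb
  have ay := aux_avg hYconv hJ hβ (fun t ht => (hys t ht).1) (fun t ht => (py t ht).1)
    hinit_yb hstep_yb
  have hβne : ∀ n : ℕ, 1 ≤ n → ¬ (1 - β (n+1) = 0) := by
    intro n hn h
    rw [hβ (n+1) (by omega)] at h
    have h1 : (1:ℝ) ≤ n := by exact_mod_cast hn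
    push_cast at h
    have h2 : (2:ℝ) / (n + 1 + 1) < 1 := by rw [div_lt_one (by linarith)]; linarith
    linarith
  refine ⟨fun n hn => ⟨(ax (n+1) (by omega)).1, (ay (n+1) (by omega)).1,
    (ax (n+1) (by omega)).2.resolve_left (hβne n hn),
    (ay (n+1) (by omega)).2.resolve_left (hβne n hn)⟩, ?_⟩
  intro x hx hgx y hy hJy n
  refine aux_potential (L := L) (Lxx := Lxx) (Lyx := Lyx) (Lyy := Lyy) hL hLxx hLyx hLyy hρ hρ' hσy hσxΦ hσxf
    (q := fun t => DyΦ (xs t) (ys t)) (s := s)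
    (Q := fun t => rQ f g Φ J x y (xb t) (yb t))
    (BX := fun t => rBreg dgfX DdgfX x (xs t)) (BY := fun t => rBreg dgfY DdgfY y (ys t))
    (A := fun n => 2 * (2 * L + (Lxx + Lyx) * n + ρ' * (σxΦ + σxf) * (n * Real.sqrt n)))
    (C := fun n => 16 * ((Lyx + Lyy) * n + ρ * σyΦ * (n * Real.sqrt n)))
    (fun _ => rfl) (fun _ => rfl) ?_ ?_ ?_ ?_ ?_ ?_ ?_ n
  · intro n
    refine le_trans ?_ (hdX.lower x hx _ (hxs (n+1) (by omega)))
    positivity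
  · intro n; exact hdX.upper x hx _ (hxs (n+1) (by omega))
  · intro n; exact hdY.lower y hy _ (hys (n+1) (by omega))
  · intro n; exact hdY.upper y hy _ (hys (n+1) (by omega))
  · intro i v
    have hG : ∀ t, DyΦ (xs t) (ys t) v + δyΦ t v = GyΦ t v := by
      intro t; rw [hδyΦ t, _root_.sub_apply]; ring
    simp only [hG]
    rcases Nat.eq_zero_or_pos i with h | h
    · subst h; simp [hinit_s]
    · rw [hstep_s i h, hθ (i+1) (by omega)]
      have : ((i:ℝ) + 1) ≠ 0 := by positivity
      push_cast
      change ((i:ℝ)+1) * ((1 + ((i:ℝ) + 1 - 1) / ((i:ℝ)+1)) * GyΦ (i+1) v - (((i:ℝ) + 1 - 1) / ((i:ℝ)+1)) * GyΦ i v) = _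
      field_simp
      ring
  · intro i hi
    have h1 := hΦyx2 _ (hxs (i+1) (by omega)).1 _ (hxs i hi).1 _ (hys (i+1) (by omega)).1
    have h2 := hΦyy _ (hxs i hi).1 _ (hys (i+1) (by omega)).1 _ (hys i hi).1
    exact le_trans (norm_sub_le_norm_sub_add_norm_sub _ (DyΦ (xs i) (ys (i+1))) _) (add_le_add h1 h2)
  · intro i
    have ht : 1 ≤ i + 1 := by omega
    have hi0 : (0:ℝ) ≤ i := Nat.cast_nonneg i
    have hb : β (i+1) = 2 / ((i:ℝ) + 2) := by rw [hβ _ ht]; push_cast; ring_nf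
    have hb0 : 0 ≤ β (i+1) := by rw [hb]; positivity
    have hb1 : 0 ≤ 1 - β (i+1) := by
      rw [hb, sub_nonneg, div_le_one (by linarith)]; linarith
    have one := aux_onestep hXconv hYconv hf_cvx hf_deriv hf_smooth hg hJ hΦcvx hΦccv hΦdx hΦdy hΦxx
      hb0 hb1 hx (hxs (i+1) ht).1 (hxs (i+2) (by omega)).1 (ax (i+1) ht).1 hy (hys (i+2) (by omega)).1
      (ay (i+1) ht).1 (ax (i+1) ht).2 (px (i+1) ht).1 (ay (i+1) ht).2 (py (i+1) ht).1
    rw [← hstep_xt (i+1) ht, ← hstep_xb (i+1) ht, ← hstep_yb (i+1) ht] at one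
    have pxx := (px (i+1) ht).2 x hx hgx
    have pyy := (py (i+1) ht).2 y hy hJy
    have lx := hdX.lower _ (hxs (i+2) (by omega)).1 _ (hxs (i+1) ht)
    have ly := hdY.lower _ (hys (i+2) (by omega)).1 _ (hys (i+1) ht)
    have e3 : i + 1 + 1 = i + 2 := rfl
    simp only [e3] at one pxx pyy
    have hsq : ((i:ℝ)+1) ^ ((3:ℝ)/2) = ((i:ℝ)+1) * Real.sqrt ((i:ℝ)+1) := by
      rw [Real.sqrt_eq_rpow, show (3:ℝ)/2 = 1 + 1/2 by norm_num,
        Real.rpow_add (by positivity), Real.rpow_one]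
    have hA0 : 0 < 2 * (2 * L + (Lxx + Lyx) * ((i:ℝ)+1)
        + ρ' * (σxΦ + σxf) * (((i:ℝ)+1) * Real.sqrt ((i:ℝ)+1))) := by positivity
    have hC0 : 0 < 16 * (Lyx + Lyy + ρ * σyΦ * Real.sqrt ((i:ℝ)+1)) := by positivity
    have hτi : ((i:ℝ)+1) * (τ (i+1))⁻¹ = 2 * (2 * L + (Lxx + Lyx) * ((i:ℝ)+1)
        + ρ' * (σxΦ + σxf) * (((i:ℝ)+1) * Real.sqrt ((i:ℝ)+1))) := by
      rw [hτ (i+1) ht]; push_cast; rw [hsq, inv_div]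
      have : ((i:ℝ) + 1) ≠ 0 := by positivity
      field_simp
    have hαi : ((i:ℝ)+1) * (α (i+1))⁻¹ = 16 * ((Lyx + Lyy) * ((i:ℝ)+1)
        + ρ * σyΦ * (((i:ℝ)+1) * Real.sqrt ((i:ℝ)+1))) := by
      rw [hα (i+1) ht]; push_cast; rw [one_div, inv_inv]; ring
    have hi1 : (0:ℝ) ≤ (i:ℝ) + 1 := by linarith
    have pxm := mul_le_mul_of_nonneg_left pxx hi1
    have pym := mul_le_mul_of_nonneg_left pyy hi1
    rw [← mul_assoc ((i:ℝ)+1) (τ (i+1))⁻¹, hτi] at pxm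
    rw [← mul_assoc ((i:ℝ)+1) (α (i+1))⁻¹, hαi] at pym
    have lxm := mul_le_mul_of_nonneg_left lx hA0.le
    have lym := mul_le_mul_of_nonneg_left ly (show 0 ≤ 16 * ((Lyx + Lyy) * ((i:ℝ)+1)
        + ρ * σyΦ * (((i:ℝ)+1) * Real.sqrt ((i:ℝ)+1))) by positivity)
    have onem := mul_le_mul_of_nonneg_left one (show 0 ≤ ((i:ℝ)+1) * (i+2) / 2 by positivity)
    have k1 : ((i:ℝ)+1) * (i+2) / 2 * (1 - β (i+1)) = (i:ℝ) * (i+1) / 2 := by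
      rw [hb]; field_simp; ring
    have k2 : ((i:ℝ)+1) * (i+2) / 2 * β (i+1) = (i:ℝ) + 1 := by
      rw [hb]; field_simp
    rw [mul_add (((i:ℝ)+1) * (i+2) / 2), ← mul_assoc _ (1 - β (i+1)), k1, ← mul_assoc _ (β (i+1)), k2] at onem
    have k3 : ((i:ℝ)+1) * ((Lxx / 2 + β (i+1) * L / 2) * ‖xs (i+2) - xs (i+1)‖ ^ 2)
        ≤ (L + Lxx * ((i:ℝ)+1) / 2) * ‖xs (i+2) - xs (i+1)‖ ^ 2 := by
      rw [← mul_assoc]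
      apply mul_le_mul_of_nonneg_right _ (by positivity)
      have : ((i:ℝ)+1) * β (i+1) ≤ 2 := by
        rw [hb, mul_div_assoc', div_le_iff₀ (by linarith)]; linarith
      have := mul_le_mul_of_nonneg_right this hL
      linarith
    have c1 : (GxΦ (i+1) + Gf (i+1)) (xs (i+2) - x) = δxΦ (i+1) (xs (i+2) - x) + δxf (i+1) (xs (i+2) - x)
        + DxΦ (xs (i+1)) (ys (i+2)) (xs (i+2) - x) + Df (xt (i+2)) (xs (i+2) - x) := by
      rw [hδxΦ, hδxf]; simp only [_root_.sub_apply, _root_.add_apply, e3]; ring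
    have c2 : (δxΦ (i+1) + δxf (i+1)) (x - xs (i+2)) = -(δxΦ (i+1) (xs (i+2) - x) + δxf (i+1) (xs (i+2) - x)) := by
      rw [← neg_sub (xs (i+2)) x, map_neg]; rfl
    have c3 : (-s (i+1)) (ys (i+2) - y) = - s (i+1) (ys (i+2) - y) := rfl
    have c4 : DyΦ (xs (i+2)) (ys (i+2)) (y - ys (i+2)) = - DyΦ (xs (i+2)) (ys (i+2)) (ys (i+2) - y) := by
      rw [← map_neg, neg_sub]
    rw [c1] at pxm
    rw [c3] at pym
    rw [c4] at onem
    simp only [Nat.cast_add, Nat.cast_one]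
    rw [c2, _root_.sub_apply]
    linarith

end Potential


section Final

variable {𝕏 𝕐 : Type*} [NormedAddCommGroup 𝕏] [NormedSpace ℝ 𝕏]
  [NormedAddCommGroup 𝕐] [NormedSpace ℝ 𝕐]

lemma aux_spS_real {f : 𝕏 → ℝ} {g : 𝕏 → EReal} {Φ : 𝕏 → 𝕐 → ℝ} {J : 𝕐 → EReal}
    {x : 𝕏} {y : 𝕐} (h1 : g x ≠ ⊤) (h2 : g x ≠ ⊥) (h3 : J y ≠ ⊤) (h4 : J y ≠ ⊥) :
    spS f g Φ J x y = ((f x + (g x).toReal + Φ x y - (J y).toReal : ℝ) : EReal) := by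
  unfold spS
  rw [EReal.coe_sub, EReal.coe_add, EReal.coe_add, EReal.coe_toReal h1 h2, EReal.coe_toReal h3 h4]

lemma aux_gap {X : Set 𝕏} {Y : Set 𝕐} {f : 𝕏 → ℝ} {g : 𝕏 → EReal} {Φ : 𝕏 → 𝕐 → ℝ}
    {J : 𝕐 → EReal} (hg : IsCCP g) (hJ : IsCCP J) {u : 𝕏} {v : 𝕐} (hu : g u ≠ ⊤) (hv : J v ≠ ⊤)
    {R : ℝ} (h : ∀ x ∈ X, g x ≠ ⊤ → ∀ y ∈ Y, J y ≠ ⊤ → rQ f g Φ J x y u v ≤ R) :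
    spGap X Y f g Φ J u v ≤ (R : EReal) := by
  have gb := hg.2.2.1
  have Jb := hJ.2.2.1
  unfold spGap
  apply EReal.sub_le_of_le_add
  refine iSup₂_le fun y hy => ?_
  by_cases hJy : J y = ⊤
  · have : spS f g Φ J u y = ⊥ := by
      unfold spS
      rw [hJy, ← EReal.coe_toReal hu (gb u), ← EReal.coe_add, ← EReal.coe_add]
      rfl
    rw [this]; exact bot_le
  · set a : ℝ := f u + (g u).toReal + Φ u y - (J y).toReal with ha
    rw [aux_spS_real hu (gb u) hJy (Jb y), ← ha]
    have key : ((a - R : ℝ) : EReal) ≤ ⨅ x' ∈ X, spS f g Φ J x' v := by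
      refine le_iInf₂ fun x hx => ?_
      by_cases hgx : g x = ⊤
      · have : spS f g Φ J x v = ⊤ := by
          unfold spS
          rw [hgx, ← EReal.coe_toReal hv (Jb v), EReal.coe_add_top, EReal.top_add_coe]
          rfl
        rw [this]; exact le_top
      · rw [aux_spS_real hgx (gb x) hv (Jb v)]
        have := h x hx hgx y hy hJy
        unfold rQ at this
        exact_mod_cast (by linarith : a - R ≤ f x + (g x).toReal + Φ x v - (J v).toReal)
    calc (a : EReal) = (R : EReal) + ((a - R : ℝ) : EReal) := by
          rw [← EReal.coe_add]; congr 1; ring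
      _ ≤ _ := add_le_add le_rfl key

lemma aux_sed {a b s t : ℝ} (hs : 0 < s) (ht : 0 < t) :
    (a + b) ^ 2 / (s + t) ≤ a ^ 2 / s + b ^ 2 / t := by
  rw [div_add_div _ _ hs.ne' ht.ne', div_le_div_iff₀ (by positivity) (by positivity)]
  nlinarith [sq_nonneg (a * t - b * s), mul_pos hs ht]

lemma aux_rN_bound {ρ ρ' σy σΦ σf OX OY DX DY ℓ sl : ℝ}
    (hρ : 0 < ρ) (hρ' : 0 < ρ') (hσy : 0 < σy) (hσΦ : 0 < σΦ) (hσf : 0 < σf)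
    {xs xh : ℕ → 𝕏} {ys yh : ℕ → 𝕐} {δ : ℕ → 𝕐 →L[ℝ] ℝ} {p r : ℕ → 𝕏 →L[ℝ] ℝ}
    {x : 𝕏} {y : 𝕐} {n : ℕ} (hn : 1 ≤ n) {W : ℝ} (hW : W = Real.sqrt ((n:ℝ) + 1))
    (qp : ∑ i ∈ Finset.range n, ‖p (i+1)‖ ^ 2 / σΦ ^ 2 ≤ n * (1 + ℓ))
    (qr : ∑ i ∈ Finset.range n, ‖r (i+1)‖ ^ 2 / σf ^ 2 ≤ n * (1 + ℓ))
    (qd : ∑ i ∈ Finset.range n, ‖δ (i+1)‖ ^ 2 / σy ^ 2 ≤ n * (1 + ℓ))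
    (lp : ∑ i ∈ Finset.range n, (-((i:ℝ)+1)) * p (i+1) (xs (i+1) - xh i) ≤ 4 * σΦ * n * W * (sl * DX))
    (lr : ∑ i ∈ Finset.range n, (-((i:ℝ)+1)) * r (i+1) (xs (i+1) - xh i) ≤ 4 * σf * n * W * (sl * DX))
    (ld : ∑ i ∈ Finset.range n, (i:ℝ) * δ (i+1) (ys (i+1) - yh i) ≤ 4 * σy * n * W * (sl * DY))
    {η η' : ℝ} (hη : η = 1 / (2 * ρ' * (σΦ + σf) * W * n)) (hη' : η' = 1 / (48 * ρ * σy * W * n))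
    (gx : ∑ i ∈ Finset.range n, (((i:ℝ)+1) • (p (i+1) + r (i+1))) (x - xh i)
      ≤ OX / η + η * ∑ i ∈ Finset.range n, ‖((i:ℝ)+1) • (p (i+1) + r (i+1))‖ ^ 2)
    (gy : ∑ i ∈ Finset.range n, ((-(i:ℝ)) • δ (i+1)) (y - yh i)
      ≤ OY / η' + η' * ∑ i ∈ Finset.range n, ‖(-(i:ℝ)) • δ (i+1)‖ ^ 2) :
    rN ρ ρ' σy σΦ σf xs ys δ p r x y n ≤
      2 * ρ' * (σΦ + σf) * W * n * OX + 48 * ρ * σy * W * n * OY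
      + 3 / 4 * (σΦ + σf) * W * n * ((1 + ℓ) / ρ') + (1 / 8 + 1 / 48) * σy * W * n * ((1 + ℓ) / ρ)
      + 4 * (σΦ + σf) * n * W * (sl * DX) + 4 * σy * n * W * (sl * DY) := by
  have hn0 : (1:ℝ) ≤ n := by exact_mod_cast hn
  have hW0 : 0 < W := by rw [hW]; positivity
  have hWW : W ^ 2 = n + 1 := by rw [hW, Real.sq_sqrt (by positivity)]
  have e0 : rN ρ ρ' σy σΦ σf xs ys δ p r x y n
      = ∑ i ∈ Finset.range n, (((i:ℝ)+1) • (p (i+1) + r (i+1))) (x - xh i)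
        + ∑ i ∈ Finset.range n, (-((i:ℝ)+1)) * p (i+1) (xs (i+1) - xh i)
        + ∑ i ∈ Finset.range n, (-((i:ℝ)+1)) * r (i+1) (xs (i+1) - xh i)
        + ∑ i ∈ Finset.range n, (i:ℝ) * δ (i+1) (ys (i+1) - yh i)
        + ∑ i ∈ Finset.range n, ((-(i:ℝ)) • δ (i+1)) (y - yh i)
        + ∑ i ∈ Finset.range n, (Real.sqrt ((i:ℝ) + 1) / (4 * ρ') * (‖p (i+1)‖ ^ 2 / σΦ + ‖r (i+1)‖ ^ 2 / σf)
          + Real.sqrt ((i:ℝ) + 1) * ‖δ (i+1)‖ ^ 2 / (8 * (ρ * σy))) := by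
    unfold rN
    simp only [← Finset.sum_add_distrib]
    refine Finset.sum_congr rfl fun i _ => ?_
    have h1 : (((i:ℝ)+1) • (p (i+1) + r (i+1))) (x - xh i)
      = ((i:ℝ)+1) * (p (i+1) (x - xh i) + r (i+1) (x - xh i)) := rfl
    have h2 : ((-(i:ℝ)) • δ (i+1)) (y - yh i) = -(i:ℝ) * δ (i+1) (y - yh i) := rfl
    have h3 : (p (i+1) + r (i+1)) (x - xs (i+1)) = p (i+1) (x - xs (i+1)) + r (i+1) (x - xs (i+1)) := rfl
    rw [h1, h2, h3]
    simp only [map_sub]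
    ring
  have bx : η * ∑ i ∈ Finset.range n, ‖((i:ℝ)+1) • (p (i+1) + r (i+1))‖ ^ 2
      ≤ ∑ i ∈ Finset.range n, W / (2 * ρ') * (‖p (i+1)‖ ^ 2 / σΦ + ‖r (i+1)‖ ^ 2 / σf) := by
    rw [Finset.mul_sum]
    refine Finset.sum_le_sum fun i hi => ?_
    have hi1 : (i:ℝ) + 1 ≤ n := by exact_mod_cast Finset.mem_range.1 hi
    have hi2 : (0:ℝ) ≤ i := Nat.cast_nonneg i
    rw [norm_smul, Real.norm_of_nonneg (by linarith)]
    have h1 := aux_sed (a := ‖p (i+1)‖) (b := ‖r (i+1)‖) hσΦ hσf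
    have h2 : (((i:ℝ)+1) * ‖p (i+1) + r (i+1)‖) ^ 2 ≤ (W ^ 2 * n) * (‖p (i+1)‖ + ‖r (i+1)‖) ^ 2 := by
      rw [mul_pow]
      apply mul_le_mul _ (by gcongr; exact norm_add_le _ _) (by positivity) (by positivity)
      rw [hWW]; nlinarith
    calc η * (((i:ℝ)+1) * ‖p (i+1) + r (i+1)‖) ^ 2
        ≤ η * ((W ^ 2 * n) * (‖p (i+1)‖ + ‖r (i+1)‖) ^ 2) := by
          apply mul_le_mul_of_nonneg_left h2; rw [hη]; positivity
      _ = W / (2 * ρ') * ((‖p (i+1)‖ + ‖r (i+1)‖) ^ 2 / (σΦ + σf)) := by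
          rw [hη]; field_simp
      _ ≤ _ := by gcongr
  have bdy : η' * ∑ i ∈ Finset.range n, ‖(-(i:ℝ)) • δ (i+1)‖ ^ 2
      ≤ ∑ i ∈ Finset.range n, W * ‖δ (i+1)‖ ^ 2 / (48 * (ρ * σy)) := by
    rw [Finset.mul_sum]
    refine Finset.sum_le_sum fun i hi => ?_
    have hi1 : (i:ℝ) + 1 ≤ n := by exact_mod_cast Finset.mem_range.1 hi
    have hi2 : (0:ℝ) ≤ i := Nat.cast_nonneg i
    rw [norm_smul, norm_neg, Real.norm_of_nonneg hi2]
    have h2 : ((i:ℝ) * ‖δ (i+1)‖) ^ 2 ≤ (W ^ 2 * n) * ‖δ (i+1)‖ ^ 2 := by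
      rw [mul_pow]
      gcongr
      rw [hWW]; nlinarith
    calc η' * ((i:ℝ) * ‖δ (i+1)‖) ^ 2
        ≤ η' * ((W ^ 2 * n) * ‖δ (i+1)‖ ^ 2) := by
          apply mul_le_mul_of_nonneg_left h2; rw [hη']; positivity
      _ = _ := by rw [hη']; field_simp
  have bs : ∑ i ∈ Finset.range n, (Real.sqrt ((i:ℝ) + 1) / (4 * ρ') * (‖p (i+1)‖ ^ 2 / σΦ + ‖r (i+1)‖ ^ 2 / σf)
          + Real.sqrt ((i:ℝ) + 1) * ‖δ (i+1)‖ ^ 2 / (8 * (ρ * σy)))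
      ≤ ∑ i ∈ Finset.range n, (W / (4 * ρ') * (‖p (i+1)‖ ^ 2 / σΦ + ‖r (i+1)‖ ^ 2 / σf)
          + W * ‖δ (i+1)‖ ^ 2 / (8 * (ρ * σy))) := by
    refine Finset.sum_le_sum fun i hi => ?_
    have hi1 : (i:ℝ) + 1 ≤ n := by exact_mod_cast Finset.mem_range.1 hi
    have : Real.sqrt ((i:ℝ) + 1) ≤ W := by rw [hW]; apply Real.sqrt_le_sqrt; linarith
    gcongr
  have tot : ∑ i ∈ Finset.range n, W / (2 * ρ') * (‖p (i+1)‖ ^ 2 / σΦ + ‖r (i+1)‖ ^ 2 / σf)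
      + ∑ i ∈ Finset.range n, W * ‖δ (i+1)‖ ^ 2 / (48 * (ρ * σy))
      + ∑ i ∈ Finset.range n, (W / (4 * ρ') * (‖p (i+1)‖ ^ 2 / σΦ + ‖r (i+1)‖ ^ 2 / σf)
          + W * ‖δ (i+1)‖ ^ 2 / (8 * (ρ * σy)))
      = 3 / 4 * W / ρ' * σΦ * (∑ i ∈ Finset.range n, ‖p (i+1)‖ ^ 2 / σΦ ^ 2)
        + 3 / 4 * W / ρ' * σf * (∑ i ∈ Finset.range n, ‖r (i+1)‖ ^ 2 / σf ^ 2)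
        + (1 / 8 + 1 / 48) * W / ρ * σy * (∑ i ∈ Finset.range n, ‖δ (i+1)‖ ^ 2 / σy ^ 2) := by
    simp only [Finset.mul_sum, ← Finset.sum_add_distrib]
    refine Finset.sum_congr rfl fun i _ => ?_
    field_simp
    ring
  have t1 := mul_le_mul_of_nonneg_left qp (show 0 ≤ 3 / 4 * W / ρ' * σΦ by positivity)
  have t2 := mul_le_mul_of_nonneg_left qr (show 0 ≤ 3 / 4 * W / ρ' * σf by positivity)
  have t3 := mul_le_mul_of_nonneg_left qd (show 0 ≤ (1 / 8 + 1 / 48) * W / ρ * σy by positivity)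
  have u1 : OX / η = 2 * ρ' * (σΦ + σf) * W * n * OX := by rw [hη]; field_simp
  have u2 : OY / η' = 48 * ρ * σy * W * n * OY := by rw [hη']; field_simp
  have u3 : 3 / 4 * (σΦ + σf) * W * n * ((1 + ℓ) / ρ') = 3 / 4 * W / ρ' * σΦ * (n * (1 + ℓ))
      + 3 / 4 * W / ρ' * σf * (n * (1 + ℓ)) := by ring
  have u4 : (1 / 8 + 1 / 48) * σy * W * n * ((1 + ℓ) / ρ)
    = (1 / 8 + 1 / 48) * W / ρ * σy * (n * (1 + ℓ)) := by ring
  rw [u1] at gx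
  rw [u2] at gy
  rw [e0, u3, u4]
  linarith

lemma aux_final_num {L Lxx Lyx Lyy ρ ρ' σy σΦ σf OX OY DX DY ℓ sl : ℝ}
    (hL : 0 ≤ L) (hLxx : 0 ≤ Lxx) (hLyx : 0 ≤ Lyx) (hLyy : 0 ≤ Lyy)
    (hρ : 0 < ρ) (hρ' : 0 < ρ') (hσy : 0 < σy) (hσΦ : 0 < σΦ) (hσf : 0 < σf)
    (hOX : 0 ≤ OX) (hOY : 0 ≤ OY) (hℓ : 0 ≤ ℓ)
    {n : ℕ} (hn : 1 ≤ n) {W : ℝ} (hW : W = Real.sqrt ((n:ℝ) + 1)) {Q N : ℝ}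
    (hN : N ≤ 2 * ρ' * (σΦ + σf) * W * n * OX + 48 * ρ * σy * W * n * OY
      + 3 / 4 * (σΦ + σf) * W * n * ((1 + ℓ) / ρ') + (1 / 8 + 1 / 48) * σy * W * n * ((1 + ℓ) / ρ)
      + 4 * (σΦ + σf) * n * W * (sl * DX) + 4 * σy * n * W * (sl * DY))
    (hQ : (n:ℝ) * (n+1) / 2 * Q
        ≤ 2 * (2 * L + (Lxx + Lyx) * n + ρ' * (σΦ + σf) * (n * Real.sqrt n)) * OX
          + 16 * ((Lyx + Lyy) * n + ρ * σy * (n * Real.sqrt n)) * OY + N) :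
    Q ≤ (16 * L / (((n:ℝ)+1) * ((n:ℝ) + 1 - 1)) * OX + 8 * (Lxx + Lyx) / ((n:ℝ)+1) * OX
            + 128 * (Lyx + Lyy) / ((n:ℝ)+1) * OY
            + 8 * σy / W * (1 / ρ + 16 * ρ * OY)
            + 8 * (σf + σΦ) / W * (1 / ρ' + ρ' * OX))
              + 8 * σy / W * (ℓ / ρ + sl * DY)
              + 8 * (σΦ + σf) / W * (ℓ / ρ' + sl * DX) := by
  have hn0 : (1:ℝ) ≤ n := by exact_mod_cast hn
  have hW0 : 0 < W := by rw [hW]; positivity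
  have hWW : (n:ℝ) + 1 = W ^ 2 := by rw [hW, Real.sq_sqrt (by positivity)]
  have hsn : Real.sqrt n ≤ W := by rw [hW]; apply Real.sqrt_le_sqrt; linarith
  have hsn0 := Real.sqrt_nonneg (n:ℝ)
  set R := (16 * L / (((n:ℝ)+1) * ((n:ℝ) + 1 - 1)) * OX + 8 * (Lxx + Lyx) / ((n:ℝ)+1) * OX
            + 128 * (Lyx + Lyy) / ((n:ℝ)+1) * OY
            + 8 * σy / W * (1 / ρ + 16 * ρ * OY)
            + 8 * (σf + σΦ) / W * (1 / ρ' + ρ' * OX))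
              + 8 * σy / W * (ℓ / ρ + sl * DY)
              + 8 * (σΦ + σf) / W * (ℓ / ρ' + sl * DX) with hR
  have key : (n:ℝ) * (n+1) / 2 * R = 8 * L * OX + 4 * (Lxx + Lyx) * n * OX + 64 * (Lyx + Lyy) * n * OY
      + 4 * σy * W * n * ((1 + ℓ) / ρ) + 64 * ρ * σy * W * n * OY + 4 * σy * n * W * (sl * DY)
      + 4 * (σΦ + σf) * W * n * ((1 + ℓ) / ρ') + 4 * ρ' * (σΦ + σf) * W * n * OX
      + 4 * (σΦ + σf) * n * W * (sl * DX) := by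
    rw [hR, add_sub_cancel_right, hWW]
    field_simp
    ring
  refine le_of_mul_le_mul_left ?_ (show 0 < (n:ℝ) * (n+1) / 2 by positivity)
  rw [key]
  have w1 : ρ' * (σΦ + σf) * (n * Real.sqrt n) * OX ≤ ρ' * (σΦ + σf) * (n * W) * OX := by gcongr
  have w2 : ρ * σy * (n * Real.sqrt n) * OY ≤ ρ * σy * (n * W) * OY := by gcongr
  have z1 : 0 ≤ L * OX := by positivity
  have z2 : 0 ≤ (Lxx + Lyx) * n * OX := by positivity
  have z3 : 0 ≤ (Lyx + Lyy) * n * OY := by positivity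
  have z4 : 0 ≤ σy * W * n * ((1 + ℓ) / ρ) := by positivity
  have z5 : 0 ≤ (σΦ + σf) * W * n * ((1 + ℓ) / ρ') := by positivity
  have y1 : 2 * (2 * L + (Lxx + Lyx) * n + ρ' * (σΦ + σf) * (n * Real.sqrt n)) * OX
    = 4 * (L * OX) + 2 * ((Lxx + Lyx) * n * OX) + 2 * (ρ' * (σΦ + σf) * (n * Real.sqrt n) * OX) := by ring
  have y2 : 16 * ((Lyx + Lyy) * n + ρ * σy * (n * Real.sqrt n)) * OY
    = 16 * ((Lyx + Lyy) * n * OY) + 16 * (ρ * σy * (n * Real.sqrt n) * OY) := by ring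
  rw [y1, y2] at hQ
  linarith

end Final


lemma aux_union6 {Ω : Type*} {mΩ : MeasurableSpace Ω} (Pr : Measure Ω) [IsProbabilityMeasure Pr]
    {s : ℝ} (hs : 0 < s) {G B1 B2 B3 B4 B5 B6 : Set Ω}
    (h1 : Pr B1 ≤ ENNReal.ofReal s) (h2 : Pr B2 ≤ ENNReal.ofReal s)
    (h3 : Pr B3 ≤ ENNReal.ofReal s) (h4 : Pr B4 ≤ ENNReal.ofReal s)
    (h5 : Pr B5 ≤ ENNReal.ofReal s) (h6 : Pr B6 ≤ ENNReal.ofReal s)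
    (hG : ∀ ω, ω ∉ B1 → ω ∉ B2 → ω ∉ B3 → ω ∉ B4 → ω ∉ B5 → ω ∉ B6 → ω ∈ G) :
    ENNReal.ofReal (1 - 6 * s) ≤ Pr G := by
  have hcov : (Set.univ : Set Ω) ⊆ G ∪ (B1 ∪ (B2 ∪ (B3 ∪ (B4 ∪ (B5 ∪ B6))))) := by
    intro ω _
    by_contra hc
    simp only [Set.mem_union, not_or] at hc
    exact hc.1 (hG ω hc.2.1 hc.2.2.1 hc.2.2.2.1 hc.2.2.2.2.1 hc.2.2.2.2.2.1 hc.2.2.2.2.2.2)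
  have hB : Pr (B1 ∪ (B2 ∪ (B3 ∪ (B4 ∪ (B5 ∪ B6))))) ≤ ENNReal.ofReal (6 * s) := by
    have e : ENNReal.ofReal (6 * s) = ENNReal.ofReal s + (ENNReal.ofReal s + (ENNReal.ofReal s
      + (ENNReal.ofReal s + (ENNReal.ofReal s + ENNReal.ofReal s)))) := by
      rw [← ENNReal.ofReal_add hs.le hs.le, ← ENNReal.ofReal_add hs.le (by positivity),
        ← ENNReal.ofReal_add hs.le (by positivity), ← ENNReal.ofReal_add hs.le (by positivity),
        ← ENNReal.ofReal_add hs.le (by positivity)]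
      congr 1; ring
    rw [e]
    refine (measure_union_le _ _).trans (add_le_add h1 ?_)
    refine (measure_union_le _ _).trans (add_le_add h2 ?_)
    refine (measure_union_le _ _).trans (add_le_add h3 ?_)
    refine (measure_union_le _ _).trans (add_le_add h4 ?_)
    exact (measure_union_le _ _).trans (add_le_add h5 h6)
  have h := (measure_mono hcov).trans (measure_union_le (μ := Pr) _ _)
  rw [measure_univ] at h
  rw [ENNReal.ofReal_sub _ (by positivity), ENNReal.ofReal_one, tsub_le_iff_right]
  exact h.trans (add_le_add le_rfl hB)

/-- Theorem 3.1(B): with the stepsize choices of Theorem 3.1 and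
unbiased conditionally sub-Gaussian noises, for every `T ≥ 3` and `ς ∈ (0,1/6]`, with
probability at least `1-6ς`, `G(x̄ᵀ,ȳᵀ)` is at most `B_E(T)` plus the deviation terms. -/
theorem algorithm1_theorem_high_probability_gap_bound
    {𝕏 𝕐 : Type*} [NormedAddCommGroup 𝕏] [NormedSpace ℝ 𝕏] [FiniteDimensional ℝ 𝕏]
    [NormedAddCommGroup 𝕐] [NormedSpace ℝ 𝕐] [FiniteDimensional ℝ 𝕐]
    {Ω : Type*} {mΩ : MeasurableSpace Ω} (Pr : MeasureTheory.Measure Ω)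
    [MeasureTheory.IsProbabilityMeasure Pr] (F : MeasureTheory.Filtration ℕ mΩ)
    (X : Set 𝕏) (Y : Set 𝕐)
    (hXne : X.Nonempty) (hXcl : IsClosed X) (hXconv : Convex ℝ X)
    (hYne : Y.Nonempty) (hYcl : IsClosed Y) (hYconv : Convex ℝ Y)
    (L Lxx Lyx Lyy : ℝ) (hL : 0 ≤ L) (hLxx : 0 ≤ Lxx) (hLyx : 0 ≤ Lyx) (hLyy : 0 ≤ Lyy)
    -- f : L-smooth and convex on X, with gradient field Df
    (f : 𝕏 → ℝ) (Df : 𝕏 → 𝕏 →L[ℝ] ℝ)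
    (hf_cvx : ConvexOn ℝ X f)
    (hf_deriv : ∀ x ∈ X, HasFDerivAt f (Df x) x)
    (hf_smooth : ∀ x ∈ X, ∀ x' ∈ X, ‖Df x - Df x'‖ ≤ L * ‖x - x'‖)
    -- g, J : CCP nonsmooth terms
    (g : 𝕏 → EReal) (hg : IsCCP g) (hgX : (edom g ∩ X).Nonempty)
    (J : 𝕐 → EReal) (hJ : IsCCP J) (hJY : (edom J ∩ Y).Nonempty)
    -- Φ : convex-concave coupling with Lipschitz partial gradients
    (Φ : 𝕏 → 𝕐 → ℝ)
    (DxΦ : 𝕏 → 𝕐 → 𝕏 →L[ℝ] ℝ) (DyΦ : 𝕏 → 𝕐 → 𝕐 →L[ℝ] ℝ)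
    (hΦcvx : ∀ y ∈ Y, ConvexOn ℝ X (fun x => Φ x y))
    (hΦccv : ∀ x ∈ X, ConcaveOn ℝ Y (Φ x))
    (hΦdx : ∀ x ∈ X, ∀ y ∈ Y, HasFDerivAt (fun x' => Φ x' y) (DxΦ x y) x)
    (hΦdy : ∀ x ∈ X, ∀ y ∈ Y, HasFDerivAt (fun y' => Φ x y') (DyΦ x y) y)
    (hΦxx : ∀ x ∈ X, ∀ x' ∈ X, ∀ y ∈ Y, ‖DxΦ x y - DxΦ x' y‖ ≤ Lxx * ‖x - x'‖)
    (hΦyx1 : ∀ x ∈ X, ∀ y ∈ Y, ∀ y' ∈ Y, ‖DxΦ x y - DxΦ x y'‖ ≤ Lyx * ‖y - y'‖)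
    (hΦyx2 : ∀ x ∈ X, ∀ x' ∈ X, ∀ y ∈ Y, ‖DyΦ x y - DyΦ x' y‖ ≤ Lyx * ‖x - x'‖)
    (hΦyy : ∀ x ∈ X, ∀ y ∈ Y, ∀ y' ∈ Y, ‖DyΦ x y - DyΦ x y'‖ ≤ Lyy * ‖y - y'‖)
    -- DGFs on X and Y with finite Bregman diameters ΩX, ΩY
    (dgfX : 𝕏 → EReal) (DdgfX : 𝕏 → 𝕏 →L[ℝ] ℝ) (hdgfX : IsDGF dgfX DdgfX X)
    (dgfY : 𝕐 → EReal) (DdgfY : 𝕐 → 𝕐 →L[ℝ] ℝ) (hdgfY : IsDGF dgfY DdgfY Y)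
    (ΩX ΩY : ℝ)
    (hΩX : (⨆ x ∈ X, ⨆ x' ∈ X ∩ interior (edom dgfX), Dbreg dgfX DdgfX x x')
      = (ΩX : EReal))
    (hΩY : (⨆ y ∈ Y, ⨆ y' ∈ Y ∩ interior (edom dgfY), Dbreg dgfY DdgfY y y')
      = (ΩY : EReal))

    -- Algorithm 1: stepsize sequences and iterates
    (θ β α τ : ℕ → ℝ)
    (xs xb xt : ℕ → Ω → 𝕏) (ys yb : ℕ → Ω → 𝕐)
    (s : ℕ → Ω → 𝕐 →L[ℝ] ℝ)
    -- stochastic gradient oracle outputs at step t: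
    -- Gf t = ∇̂f(x̃^{t+1}), GxΦ t = ∇̂ₓΦ(xᵗ,y^{t+1}), GyΦ t = ∇̂_yΦ(xᵗ,yᵗ)
    (Gf GxΦ : ℕ → Ω → 𝕏 →L[ℝ] ℝ) (GyΦ : ℕ → Ω → 𝕐 →L[ℝ] ℝ)
    (hinit_x : ∀ ω, xs 1 ω ∈ X ∩ interior (edom dgfX))
    (hinit_y : ∀ ω, ys 1 ω ∈ Y ∩ interior (edom dgfY))
    (hinit_xb : xb 1 = xs 1) (hinit_yb : yb 1 = ys 1) (hinit_s : s 1 = GyΦ 1)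
    (hstep_y : ∀ t, 1 ≤ t → ∀ ω, ys (t+1) ω ∈ Y ∩ interior (edom dgfY) ∧
      ∀ y ∈ Y,
        J (ys (t+1) ω) + ((-((s t ω) (ys (t+1) ω - ys t ω)) : ℝ) : EReal)
            + (((α t)⁻¹ : ℝ) : EReal) * Dbreg dgfY DdgfY (ys (t+1) ω) (ys t ω)
          ≤ J y + ((-((s t ω) (y - ys t ω)) : ℝ) : EReal)
            + (((α t)⁻¹ : ℝ) : EReal) * Dbreg dgfY DdgfY y (ys t ω))
    (hstep_xt : ∀ t, 1 ≤ t → ∀ ω, xt (t+1) ω = (1 - β t) • xb t ω + β t • xs t ω)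
    (hstep_x : ∀ t, 1 ≤ t → ∀ ω, xs (t+1) ω ∈ X ∩ interior (edom dgfX) ∧
      ∀ x ∈ X,
        g (xs (t+1) ω) + (((GxΦ t ω + Gf t ω) (xs (t+1) ω - xs t ω) : ℝ) : EReal)
            + (((τ t)⁻¹ : ℝ) : EReal) * Dbreg dgfX DdgfX (xs (t+1) ω) (xs t ω)
          ≤ g x + (((GxΦ t ω + Gf t ω) (x - xs t ω) : ℝ) : EReal)
            + (((τ t)⁻¹ : ℝ) : EReal) * Dbreg dgfX DdgfX x (xs t ω))
    (hstep_s : ∀ t, 1 ≤ t → ∀ ω,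
      s (t+1) ω = (1 + θ (t+1)) • GyΦ (t+1) ω - θ (t+1) • GyΦ t ω)
    (hstep_xb : ∀ t, 1 ≤ t → ∀ ω, xb (t+1) ω = (1 - β t) • xb t ω + β t • xs (t+1) ω)
    (hstep_yb : ∀ t, 1 ≤ t → ∀ ω, yb (t+1) ω = (1 - β t) • yb t ω + β t • ys (t+1) ω)

    -- gradient noises, adaptedness and unbiasedness
    (δyΦ : ℕ → Ω → 𝕐 →L[ℝ] ℝ) (δxΦ δxf : ℕ → Ω → 𝕏 →L[ℝ] ℝ)
    (hδyΦ : ∀ t ω, δyΦ t ω = GyΦ t ω - DyΦ (xs t ω) (ys t ω))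
    (hδxΦ : ∀ t ω, δxΦ t ω = GxΦ t ω - DxΦ (xs t ω) (ys (t+1) ω))
    (hδxf : ∀ t ω, δxf t ω = Gf t ω - Df (xt (t+1) ω))
    (hadapt_x : ∀ t, 1 ≤ t → StronglyMeasurable[F (t-1)] (xs t))
    (hadapt_y : ∀ t, 1 ≤ t → StronglyMeasurable[F (t-1)] (ys t))
    (hmeas : ∀ t, 1 ≤ t → StronglyMeasurable[F t] (δyΦ t) ∧
      StronglyMeasurable[F t] (δxΦ t) ∧ StronglyMeasurable[F t] (δxf t))
    (hint : ∀ t, 1 ≤ t → MeasureTheory.Integrable (δyΦ t) Pr ∧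
      MeasureTheory.Integrable (δxΦ t) Pr ∧ MeasureTheory.Integrable (δxf t) Pr)
    (hunbiased : ∀ t, 1 ≤ t → (Pr[δyΦ t | F (t-1)] =ᵐ[Pr] 0) ∧
      (Pr[δxΦ t | F (t-1)] =ᵐ[Pr] 0) ∧ (Pr[δxf t | F (t-1)] =ᵐ[Pr] 0))
    (σyΦ σxΦ σxf : ℝ) (hσy : 0 < σyΦ) (hσxΦ : 0 < σxΦ) (hσxf : 0 < σxf)

    -- conditionally sub-Gaussian noises
    (hsg_int : ∀ t, 1 ≤ t →
      MeasureTheory.Integrable (fun ω => Real.exp (‖δyΦ t ω‖ ^ 2 / σyΦ ^ 2)) Pr ∧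
      MeasureTheory.Integrable (fun ω => Real.exp (‖δxΦ t ω‖ ^ 2 / σxΦ ^ 2)) Pr ∧
      MeasureTheory.Integrable (fun ω => Real.exp (‖δxf t ω‖ ^ 2 / σxf ^ 2)) Pr)
    (hsg : ∀ t, 1 ≤ t →
      (∀ᵐ ω ∂Pr, (Pr[fun ω' => Real.exp (‖δyΦ t ω'‖ ^ 2 / σyΦ ^ 2) | F (t-1)]) ω
        ≤ Real.exp 1) ∧
      (∀ᵐ ω ∂Pr, (Pr[fun ω' => Real.exp (‖δxΦ t ω'‖ ^ 2 / σxΦ ^ 2) | F (t-1)]) ω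
        ≤ Real.exp 1) ∧
      (∀ᵐ ω ∂Pr, (Pr[fun ω' => Real.exp (‖δxf t ω'‖ ^ 2 / σxf ^ 2) | F (t-1)]) ω
        ≤ Real.exp 1))

    -- parameter choices of Theorem 3.1
    (ρ ρ' : ℝ) (hρ : 0 < ρ) (hρ' : 0 < ρ')
    (hθ : ∀ t : ℕ, 1 ≤ t → θ t = ((t : ℝ) - 1) / t)
    (hβ : ∀ t : ℕ, 1 ≤ t → β t = 2 / ((t : ℝ) + 1))
    (hα : ∀ t : ℕ, 1 ≤ t →
      α t = 1 / (16 * (Lyx + Lyy + ρ * σyΦ * Real.sqrt t)))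
    (hτ : ∀ t : ℕ, 1 ≤ t →
      τ t = (t : ℝ) / (2 * (2 * L + (Lxx + Lyx) * t
        + ρ' * (σxΦ + σxf) * (t : ℝ) ^ ((3 : ℝ) / 2))))

    -- diameters of X and Y
    (DX DY : ℝ)
    (hDX : ∀ x ∈ X, ∀ x' ∈ X, ‖x - x'‖ ≤ DX) (hDY : ∀ y ∈ Y, ∀ y' ∈ Y, ‖y - y'‖ ≤ DY)
 :
    ∀ T : ℕ, 3 ≤ T → ∀ ς : ℝ, 0 < ς → ς ≤ 1 / 6 →
      ENNReal.ofReal (1 - 6 * ς) ≤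
        Pr {ω | spGap X Y f g Φ J (xb T ω) (yb T ω)
          ≤ (((16 * L / (T * ((T:ℝ) - 1)) * ΩX + 8 * (Lxx + Lyx) / T * ΩX
            + 128 * (Lyx + Lyy) / T * ΩY
            + 8 * σyΦ / Real.sqrt T * (1 / ρ + 16 * ρ * ΩY)
            + 8 * (σxf + σxΦ) / Real.sqrt T * (1 / ρ' + ρ' * ΩX))
              + 8 * σyΦ / Real.sqrt T *
                  (Real.log (1 / ς) / ρ + Real.sqrt (Real.log (1 / ς)) * DY)
              + 8 * (σxΦ + σxf) / Real.sqrt T *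
                  (Real.log (1 / ς) / ρ' + Real.sqrt (Real.log (1 / ς)) * DX) : ℝ) : EReal)} := by
  intro T hT ς hς hς6
  obtain ⟨n, rfl⟩ : ∃ n, T = n + 1 := ⟨T - 1, by omega⟩
  have hn : 1 ≤ n := by omega
  have hn0 : (1:ℝ) ≤ n := by exact_mod_cast hn
  have hς1 : ς ≤ 1 := by linarith
  have hℓ : 0 ≤ Real.log (1 / ς) := by
    apply Real.log_nonneg; rw [le_div_iff₀ hς]; linarith
  obtain ⟨ω0⟩ : Nonempty Ω := Pr.nonempty_of_neZero
  have hdX := aux_dgfData hdgfX hΩX ⟨_, hinit_x ω0⟩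
  have hdY := aux_dgfData hdgfY hΩY ⟨_, hinit_y ω0⟩
  have hOX : 0 ≤ ΩX := le_trans (le_trans (by positivity)
    (hdX.lower _ (hinit_x ω0).1 _ (hinit_x ω0))) (hdX.upper _ (hinit_x ω0).1 _ (hinit_x ω0))
  have hOY : 0 ≤ ΩY := le_trans (le_trans (by positivity)
    (hdY.lower _ (hinit_y ω0).1 _ (hinit_y ω0))) (hdY.upper _ (hinit_y ω0).1 _ (hinit_y ω0))
  have hDX0 : 0 ≤ DX := le_trans (norm_nonneg _) (hDX _ (hinit_x ω0).1 _ (hinit_x ω0).1)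
  have hDY0 : 0 ≤ DY := le_trans (norm_nonneg _) (hDY _ (hinit_y ω0).1 _ (hinit_y ω0).1)
  obtain ⟨MX, hMXc, hMXU, hMX⟩ := aux_dualmap hdX hXconv hXcl hDX ⟨_, hinit_x ω0⟩
  obtain ⟨MY, hMYc, hMYU, hMY⟩ := aux_dualmap hdY hYconv hYcl hDY ⟨_, hinit_y ω0⟩
  set W : ℝ := Real.sqrt ((n:ℝ) + 1) with hW
  have hW0 : 0 < W := by rw [hW]; positivity
  set ηx : ℝ := 1 / (2 * ρ' * (σxΦ + σxf) * W * n) with hηx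
  set ηy : ℝ := 1 / (48 * ρ * σyΦ * W * n) with hηy
  have hηx0 : 0 < ηx := by rw [hηx]; positivity
  have hηy0 : 0 < ηy := by rw [hηy]; positivity
  -- ghost iterates
  let ξx : ℕ → Ω → 𝕏 →L[ℝ] ℝ := fun i ω => ((i:ℝ)+1) • (δxΦ (i+1) ω + δxf (i+1) ω)
  let ξy : ℕ → Ω → 𝕐 →L[ℝ] ℝ := fun i ω => (-(i:ℝ)) • δyΦ (i+1) ω
  let xh : ℕ → Ω → 𝕏 := fun i ω => MX (DdgfX (xs 1 ω0) + ηx • ∑ j ∈ Finset.range i, ξx j ω)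
  let yh : ℕ → Ω → 𝕐 := fun i ω => MY (DdgfY (ys 1 ω0) + ηy • ∑ j ∈ Finset.range i, ξy j ω)
  have hξx : ∀ i j, j < i → StronglyMeasurable[F i] (ξx j) := by
    intro i j hij
    have h1 := (hmeas (j+1) (by omega)).2.1.mono (F.mono (show j + 1 ≤ i by omega))
    have h2 := (hmeas (j+1) (by omega)).2.2.mono (F.mono (show j + 1 ≤ i by omega))
    exact (h1.add h2).const_smul ((j:ℝ)+1)
  have hξy : ∀ i j, j < i → StronglyMeasurable[F i] (ξy j) := by
    intro i j hij
    have h1 := (hmeas (j+1) (by omega)).1.mono (F.mono (show j + 1 ≤ i by omega))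
    exact h1.const_smul (-(j:ℝ))
  have hxh : ∀ i, StronglyMeasurable[F i] (xh i) := by
    intro i
    refine hMXc.comp_stronglyMeasurable ?_
    have h0 : StronglyMeasurable[F i] (fun ω => ∑ j ∈ Finset.range i, ξx j ω) :=
      Finset.stronglyMeasurable_fun_sum _ fun j hj => hξx i j (Finset.mem_range.1 hj)
    exact stronglyMeasurable_const.add (h0.const_smul ηx)
  have hyh : ∀ i, StronglyMeasurable[F i] (yh i) := by
    intro i
    refine hMYc.comp_stronglyMeasurable ?_
    have h0 : StronglyMeasurable[F i] (fun ω => ∑ j ∈ Finset.range i, ξy j ω) :=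
      Finset.stronglyMeasurable_fun_sum _ fun j hj => hξy i j (Finset.mem_range.1 hj)
    exact stronglyMeasurable_const.add (h0.const_smul ηy)
  have hxsX : ∀ i ω, xs (i+1) ω ∈ X := by
    intro i ω
    rcases Nat.eq_zero_or_pos i with h | h
    · subst h; exact (hinit_x ω).1
    · exact (hstep_x i h ω).1.1
  have hysY : ∀ i ω, ys (i+1) ω ∈ Y := by
    intro i ω
    rcases Nat.eq_zero_or_pos i with h | h
    · subst h; exact (hinit_y ω).1
    · exact (hstep_y i h ω).1.1
  have hux : ∀ i, StronglyMeasurable[F i] (fun ω => xs (i+1) ω - xh i ω) :=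
    fun i => (hadapt_x (i+1) (by omega)).sub (hxh i)
  have huy : ∀ i, StronglyMeasurable[F i] (fun ω => ys (i+1) ω - yh i ω) :=
    fun i => (hadapt_y (i+1) (by omega)).sub (hyh i)
  have p1 : ∀ i : ℕ, 1 ≤ i + 1 := fun i => by omega
  -- six tail bounds
  have q1 := aux_quad_tail F (δ := fun i => δyΦ (i+1)) (σ := σyΦ) (fun i => (hmeas (i+1) (p1 i)).1)
    (fun i => (hsg_int (i+1) (p1 i)).1) (fun i => (hsg (i+1) (p1 i)).1) n hn hς
  have q2 := aux_quad_tail F (δ := fun i => δxΦ (i+1)) (σ := σxΦ) (fun i => (hmeas (i+1) (p1 i)).2.1)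
    (fun i => (hsg_int (i+1) (p1 i)).2.1) (fun i => (hsg (i+1) (p1 i)).2.1) n hn hς
  have q3 := aux_quad_tail F (δ := fun i => δxf (i+1)) (σ := σxf) (fun i => (hmeas (i+1) (p1 i)).2.2)
    (fun i => (hsg_int (i+1) (p1 i)).2.2) (fun i => (hsg (i+1) (p1 i)).2.2) n hn hς
  have hw1 : ∀ i < n, |(i:ℝ)| ≤ n := by
    intro i hi
    rw [abs_of_nonneg (Nat.cast_nonneg i)]
    exact_mod_cast hi.le
  have hw2 : ∀ i < n, |-((i:ℝ)+1)| ≤ n := by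
    intro i hi
    rw [abs_neg, abs_of_nonneg (by positivity)]
    exact_mod_cast hi
  have l1 := aux_lin_tail F (δ := fun i => δyΦ (i+1)) (u := fun i ω => ys (i+1) ω - yh i ω)
    (w := fun i => (i:ℝ)) (σ := σyΦ) (D := DY) hσy hDY0 huy
    (fun i ω => hDY _ (hysY i ω) _ (hMYU _)) (fun i => (hmeas (i+1) (p1 i)).1)
    (fun i => (hint (i+1) (p1 i)).1) (fun i => (hunbiased (i+1) (p1 i)).1)
    (fun i => (hsg_int (i+1) (p1 i)).1) (fun i => (hsg (i+1) (p1 i)).1) n hn hw1 hς hς1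
  have l2 := aux_lin_tail F (δ := fun i => δxΦ (i+1)) (u := fun i ω => xs (i+1) ω - xh i ω)
    (w := fun i => -((i:ℝ)+1)) (σ := σxΦ) (D := DX) hσxΦ hDX0 hux
    (fun i ω => hDX _ (hxsX i ω) _ (hMXU _)) (fun i => (hmeas (i+1) (p1 i)).2.1)
    (fun i => (hint (i+1) (p1 i)).2.1) (fun i => (hunbiased (i+1) (p1 i)).2.1)
    (fun i => (hsg_int (i+1) (p1 i)).2.1) (fun i => (hsg (i+1) (p1 i)).2.1) n hn hw2 hς hς1
  have l3 := aux_lin_tail F (δ := fun i => δxf (i+1)) (u := fun i ω => xs (i+1) ω - xh i ω)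
    (w := fun i => -((i:ℝ)+1)) (σ := σxf) (D := DX) hσxf hDX0 hux
    (fun i ω => hDX _ (hxsX i ω) _ (hMXU _)) (fun i => (hmeas (i+1) (p1 i)).2.2)
    (fun i => (hint (i+1) (p1 i)).2.2) (fun i => (hunbiased (i+1) (p1 i)).2.2)
    (fun i => (hsg_int (i+1) (p1 i)).2.2) (fun i => (hsg (i+1) (p1 i)).2.2) n hn hw2 hς hς1
  refine aux_union6 Pr hς q1 q2 q3 l1 l2 l3 ?_
  intro ω g1 g2 g3 g4 g5 g6
  rw [Set.mem_ofPred_eq, not_lt] at g1 g2 g3 g4 g5 g6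
  rw [Set.mem_ofPred_eq]
  obtain ⟨hfin, hdet⟩ := aux_det hXconv hYconv hL hLxx hLyx hLyy hf_cvx hf_deriv hf_smooth hg hgX hJ hJY
    hΦcvx hΦccv hΦdx hΦdy hΦxx hΦyx2 hΦyy hdX hdY
    (xs := fun t => xs t ω) (xb := fun t => xb t ω) (xt := fun t => xt t ω)
    (ys := fun t => ys t ω) (yb := fun t => yb t ω) (s := fun t => s t ω)
    (Gf := fun t => Gf t ω) (GxΦ := fun t => GxΦ t ω) (GyΦ := fun t => GyΦ t ω)
    (θ := θ) (β := β) (α := α) (τ := τ)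
    (hinit_x ω) (hinit_y ω) (congrFun hinit_xb ω) (congrFun hinit_yb ω) (congrFun hinit_s ω)
    (fun t ht => hstep_y t ht ω) (fun t ht => hstep_xt t ht ω) (fun t ht => hstep_x t ht ω)
    (fun t ht => hstep_s t ht ω) (fun t ht => hstep_xb t ht ω) (fun t ht => hstep_yb t ht ω)
    (δyΦ := fun t => δyΦ t ω) (δxΦ := fun t => δxΦ t ω) (δxf := fun t => δxf t ω)
    (fun t => hδyΦ t ω) (fun t => hδxΦ t ω) (fun t => hδxf t ω) hσy hσxΦ hσxf hρ hρ' hθ hβ hα hτ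
  obtain ⟨-, -, hgfin, hJfin⟩ := hfin n hn
  refine aux_gap hg hJ hgfin hJfin ?_
  intro x hx hgx y hy hJy
  have hQ := hdet x hx hgx y hy hJy n
  have hN := aux_rN_bound (x := x) (y := y) (OX := ΩX) (OY := ΩY) (DX := DX) (DY := DY)
    (ℓ := Real.log (1 / ς)) (sl := Real.sqrt (Real.log (1 / ς)))
    (xs := fun t => xs t ω) (ys := fun t => ys t ω) (xh := fun i => xh i ω) (yh := fun i => yh i ω)
    (δ := fun t => δyΦ t ω) (p := fun t => δxΦ t ω) (r := fun t => δxf t ω)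
    hρ hρ' hσy hσxΦ hσxf hn hW g2 g3 g1 g5 g6 g4 hηx hηy
    (aux_ghost hdX (hinit_x ω0) hMXU hMX hηx0 (fun i => ξx i ω) n hx)
    (aux_ghost hdY (hinit_y ω0) hMYU hMY hηy0 (fun i => ξy i ω) n hy)
  have hfinal := aux_final_num hL hLxx hLyx hLyy hρ hρ' hσy hσxΦ hσxf hOX hOY hℓ hn hW hN hQ
  push_cast
  exact hfinal
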